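/- Let φ be an anisotropy on ℝ² whose Wulff shape W^φ is symmetric with respect to both coordinate axes and has no vertical facets, let I ⊂ ℝ be a bounded open interval and let p ∈ [1,+∞). Then there exists σ = σ(φ,p,|I|) > 0 such that for every g ∈ L^∞(I) with ‖g‖_∞ < σ, every minimizer of G over L¹(I) is Lipschitz on I. If, in addition, φ is a C²-anisotropy and is elliptic, then every such minimizer is C^{1,1} on I, i.e. continuously differentiable with Lipschitz derivative. -/

import Mathlib

open MeasureTheory Set Filter Topology Bornology
open scoped ENNReal NNReal RealInnerProductSpace symmDiff

noncomputable section

abbrev E2 : Type := EuclideanSpace ℝ (Fin 2)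

def vec2 (a b : ℝ) : E2 := (WithLp.equiv 2 (Fin 2 → ℝ)).symm ![a, b]

def e1 : E2 := vec2 1 0
def e2 : E2 := vec2 0 1

/-- `φ` is an anisotropy (a norm) on `ℝ²`. -/
structure IsAnisotropy (φ : E2 → ℝ) : Prop where
  nonneg : ∀ x, 0 ≤ φ x
  eq_zero_iff : ∀ x, φ x = 0 ↔ x = 0
  smul_eq : ∀ (c : ℝ) (x : E2), φ (c • x) = |c| * φ x
  add_le : ∀ x y, φ (x + y) ≤ φ x + φ y
  bounds : ∃ c ∈ Set.Ioc (0:ℝ) 1, ∀ x : E2, ‖x‖ = 1 → c ≤ φ x ∧ φ x ≤ 1 / c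

/-- The dual anisotropy `φ°(ξ) = max {⟪ξ,η⟫ : φ(η) = 1}`. -/
def dualA (φ : E2 → ℝ) (ξ : E2) : ℝ := sSup {r : ℝ | ∃ η : E2, φ η = 1 ∧ r = ⟪ξ, η⟫}

/-- The Wulff shape `W^φ = {φ ≤ 1}`. -/
def wulff (φ : E2 → ℝ) : Set E2 := {x | φ x ≤ 1}

/-- The Wulff shape of radius `r` centered at `x`. -/
def wulffBall (φ : E2 → ℝ) (r : ℝ) (x : E2) : Set E2 := {y | φ (y - x) ≤ r}

/-- `φ` is partially monotone, i.e. even in each coordinate separately. -/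
def PartiallyMonotone (φ : E2 → ℝ) : Prop := ∀ x : E2, φ x = φ (vec2 |x 0| |x 1|)

/-- The Wulff shape of `φ` is symmetric with respect to both coordinate axes. -/
def AxisSymmetric (φ : E2 → ℝ) : Prop :=
  ∀ x : E2, φ (vec2 (-(x 0)) (x 1)) = φ x ∧ φ (vec2 (x 0) (-(x 1))) = φ x

/-- `W^φ` has no vertical facets: `±e₁` is an outer normal to `W^φ` only at `±e₁/φ(e₁)`. -/
def NoVerticalFacets (φ : E2 → ℝ) : Prop :=
  (∀ η ∈ wulff φ, (∀ y ∈ wulff φ, ⟪e1, y - η⟫ ≤ 0) → η = (φ e1)⁻¹ • e1) ∧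
  (∀ η ∈ wulff φ, (∀ y ∈ wulff φ, ⟪-e1, y - η⟫ ≤ 0) → η = -((φ e1)⁻¹ • e1))

/-- `φ` is elliptic: `φ - λ|·|` is again a norm for some `λ > 0`. -/
def IsElliptic (φ : E2 → ℝ) : Prop :=
  ∃ lam > (0:ℝ), IsAnisotropy (fun x => φ x - lam * ‖x‖)

/-- `φ` is a `C²`-anisotropy. -/
def IsC2Aniso (φ : E2 → ℝ) : Prop := ContDiffOn ℝ 2 φ {(0:E2)}ᶜ

/-- The anisotropic area `𝒜_φ(u,J)` (φ-total variation of `(-Du, L¹)`). -/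
def aniArea (φ : E2 → ℝ) (u : ℝ → ℝ) (J : Set ℝ) : ℝ≥0∞ :=
  ⨆ (h₁ : ℝ → ℝ) (h₂ : ℝ → ℝ) (_ : ContDiff ℝ 1 h₁) (_ : ContDiff ℝ 1 h₂)
    (_ : HasCompactSupport h₁) (_ : HasCompactSupport h₂)
    (_ : tsupport h₁ ⊆ J) (_ : tsupport h₂ ⊆ J)
    (_ : ∀ s ∈ J, φ (vec2 (h₁ s) (h₂ s)) ≤ 1),
    ENNReal.ofReal (∫ s in J, (u s * deriv h₁ s + h₂ s))

/-- The (Euclidean) total variation of `Du` on `J`. -/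
def totalVar (u : ℝ → ℝ) (J : Set ℝ) : ℝ≥0∞ :=
  ⨆ (h : ℝ → ℝ) (_ : ContDiff ℝ 1 h) (_ : HasCompactSupport h) (_ : tsupport h ⊆ J)
    (_ : ∀ s ∈ J, |h s| ≤ 1), ENNReal.ofReal (∫ s in J, u s * deriv h s)

/-- `u ∈ BV(I)`. -/
def BVOn (u : ℝ → ℝ) (I : Set ℝ) : Prop := IntegrableOn u I ∧ totalVar u I < ⊤

/-- `u ∈ BV_loc(I)`. -/
def BVLocOn (u : ℝ → ℝ) (I : Set ℝ) : Prop :=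
  ∀ J : Set ℝ, IsOpen J → IsCompact (closure J) → closure J ⊆ I → BVOn u J

/-- The `L^∞`-norm of `u` on `I`. -/
def supNorm (u : ℝ → ℝ) (I : Set ℝ) : ℝ≥0∞ :=
  essSup (fun s => (‖u s‖₊ : ℝ≥0∞)) (volume.restrict I)

/-- The functional `G(u) = 𝒜_φ(u,I) + ∫_I |u-g|^p ds` (with value `+∞` when
`u ∉ BV(I)` or `u - g ∉ L^p(I)`). -/
def Gfun (φ : E2 → ℝ) (p : ℝ) (g : ℝ → ℝ) (I : Set ℝ) (u : ℝ → ℝ) : ℝ≥0∞ :=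
  aniArea φ u I + ∫⁻ s in I, ENNReal.ofReal (|u s - g s| ^ p)

/-- `u` minimizes `G` over `L¹(I)`. -/
def IsMinimizerG (φ : E2 → ℝ) (p : ℝ) (g : ℝ → ℝ) (I : Set ℝ) (u : ℝ → ℝ) : Prop :=
  IntegrableOn u I ∧ ∀ v : ℝ → ℝ, IntegrableOn v I → Gfun φ p g I u ≤ Gfun φ p g I v

/-- `u` is a `Λ`-local minimizer of `𝒜_φ` in `I`. -/
def IsLambdaLocMin (φ : E2 → ℝ) (Λ : ℝ) (I : Set ℝ) (u : ℝ → ℝ) : Prop :=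
  ∀ J : Set ℝ, IsOpen J → IsCompact (closure J) → closure J ⊆ I →
    ∀ ψ : ℝ → ℝ, ContDiff ℝ 1 ψ → HasCompactSupport ψ → tsupport ψ ⊆ J →
      aniArea φ u J ≤ aniArea φ (fun s => u s + ψ s) J + ENNReal.ofReal (Λ * ∫ s in J, |ψ s|)

/-- `ν` is the measure-theoretic outer unit normal of `E` at `x` (De Giorgi blow-up). -/
def IsOuterNormalAt (E : Set E2) (x ν : E2) : Prop :=
  ‖ν‖ = 1 ∧ Tendsto
    (fun r : ℝ => volume (({y : E2 | x + r • y ∈ E} ∆ {y : E2 | ⟪y, ν⟫ ≤ 0}) ∩ Metric.ball (0:E2) 1))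
    (𝓝[>] 0) (𝓝 0)

/-- The reduced boundary `∂*E`. -/
def redBoundary (E : Set E2) : Set E2 := {x | ∃ ν, IsOuterNormalAt E x ν}

open Classical in
/-- The generalized outer unit normal `ν_E`. -/
def genNormal (E : Set E2) (x : E2) : E2 :=
  if h : ∃ ν, IsOuterNormalAt E x ν then h.choose else 0

/-- The anisotropic perimeter `P_φ(E,Ω) = ∫_{Ω ∩ ∂*E} φ°(ν_E) dH¹`. -/
def aniPer (φ : E2 → ℝ) (E : Set E2) (Ω : Set E2) : ℝ≥0∞ :=
  ∫⁻ x in Ω ∩ redBoundary E, ENNReal.ofReal (dualA φ (genNormal E x)) ∂μH[1]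

/-- The divergence of a vector field on `ℝ²`. -/
def div2 (T : E2 → E2) (x : E2) : ℝ :=
  ∑ i : Fin 2, fderiv ℝ T x (EuclideanSpace.single i 1) i

/-- Distributional perimeter of `F` in an open set `Ω`. -/
def perVar (F : Set E2) (Ω : Set E2) : ℝ≥0∞ :=
  ⨆ (T : E2 → E2) (_ : ContDiff ℝ 1 T) (_ : HasCompactSupport T) (_ : tsupport T ⊆ Ω)
    (_ : ∀ x, ‖T x‖ ≤ 1), ENNReal.ofReal (∫ x in F, div2 T x)

/-- `F` has locally finite perimeter in `Ω`. -/
def LocFinPer (F : Set E2) (Ω : Set E2) : Prop :=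
  MeasurableSet F ∧ ∀ Ω' : Set E2, IsOpen Ω' → IsCompact (closure Ω') → closure Ω' ⊆ Ω →
    perVar F Ω' < ⊤

/-- `E` is a `Λ`-local minimizer of `P_φ` in `Ω`. -/
def IsLambdaLocMinPer (φ : E2 → ℝ) (Λ : ℝ) (Ω : Set E2) (E : Set E2) : Prop :=
  LocFinPer E Ω ∧ ∀ Ω' : Set E2, IsOpen Ω' → IsCompact (closure Ω') → closure Ω' ⊆ Ω →
    ∀ F : Set E2, LocFinPer F Ω → IsCompact (closure (E ∆ F)) → closure (E ∆ F) ⊆ Ω' →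
      aniPer φ E Ω' ≤ aniPer φ F Ω' + ENNReal.ofReal Λ * volume (E ∆ F)

/-- The (strict) subgraph of `u` over `I`. -/
def subg (I : Set ℝ) (u : ℝ → ℝ) : Set E2 := {q : E2 | q 0 ∈ I ∧ q 1 < u (q 0)}

/-- The (strict) epigraph of `u` over `I`. -/
def epig (I : Set ℝ) (u : ℝ → ℝ) : Set E2 := {q : E2 | q 0 ∈ I ∧ u (q 0) < q 1}

/-- The vertical strip `I × ℝ`. -/
def strip (I : Set ℝ) : Set E2 := {q : E2 | q 0 ∈ I}

/-- The vertical box `I × A`. -/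
def box (I A : Set ℝ) : Set E2 := {q : E2 | q 0 ∈ I ∧ q 1 ∈ A}

/-- `u` is a `(γ,Λ)`-local minimizer of `𝒜_φ` in `I`. -/
def IsGammaLambdaLocMin (φ : E2 → ℝ) (γ Λ : ℝ) (I : Set ℝ) (u : ℝ → ℝ) : Prop :=
  ∀ Ω : Set E2, IsOpen Ω → IsCompact (closure Ω) → closure Ω ⊆ box I (Set.Ioo (-γ) γ) →
    ∀ F : Set E2, LocFinPer F (strip I) →
      IsCompact (closure (subg I u ∆ F)) → closure (subg I u ∆ F) ⊆ Ω →
        aniPer φ (subg I u) Ω ≤ aniPer φ F Ω + ENNReal.ofReal Λ * volume (subg I u ∆ F)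

/-- The constant `α₀(φ)`. -/
def alpha0 (φ : E2 → ℝ) : ℝ :=
  (aniPer φ (wulff φ) univ).toReal /
    ((2 * (aniPer φ (wulff φ) univ).toReal + 1) * Real.sqrt (volume (wulff φ)).toReal)

/-- `u` admits a Lipschitz representative on `I`. -/
def HasLipschitzRep (u : ℝ → ℝ) (I : Set ℝ) : Prop :=
  ∃ v : ℝ → ℝ, (∀ᵐ s ∂(volume.restrict I), u s = v s) ∧ ∃ K : ℝ≥0, LipschitzOnWith K v I

/-- `u` admits a `C^{1,1}` representative on `I`. -/
def HasC11Rep (u : ℝ → ℝ) (I : Set ℝ) : Prop :=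
  ∃ v v' : ℝ → ℝ, (∀ᵐ s ∂(volume.restrict I), u s = v s) ∧
    (∀ s ∈ I, HasDerivAt v (v' s) s) ∧ ∃ K : ℝ≥0, LipschitzOnWith K v' I

@[simp] lemma vec2_zero (a b : ℝ) : vec2 a b 0 = a := rfl

@[simp] lemma vec2_one (a b : ℝ) : vec2 a b 1 = b := rfl

lemma vec2_eta (x : E2) : vec2 (x 0) (x 1) = x := by
  ext i; fin_cases i <;> rfl

lemma vec2_add (a b c d : ℝ) : vec2 a b + vec2 c d = vec2 (a + c) (b + d) := by
  ext i; fin_cases i <;> simp [vec2]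

lemma smul_vec2 (c a b : ℝ) : c • vec2 a b = vec2 (c * a) (c * b) := by
  ext i; fin_cases i <;> simp [vec2]

lemma contDiff_vec2 {n : WithTop ℕ∞} : ContDiff ℝ n (fun q : ℝ × ℝ => vec2 q.1 q.2) := by
  unfold vec2
  rw [contDiff_euclidean]
  intro i
  fin_cases i
  · exact contDiff_fst
  · exact contDiff_snd

/-- The boundary profile of the Wulff shape: the largest ordinate above the abscissa `t`. -/
def wulffProfile (φ : E2 → ℝ) (t : ℝ) : ℝ := sSup {s | φ (vec2 t s) ≤ 1}

/-- The half width of the Wulff shape. -/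
def wulffWidth (φ : E2 → ℝ) : ℝ := (φ e1)⁻¹

/-- The properties of the boundary profile of an axis-symmetric Wulff shape of half width `m`
without vertical facets. -/
structure IsProfile (m : ℝ) (H : ℝ → ℝ) : Prop where
  m_pos : 0 < m
  cont : Continuous H
  nonneg : ∀ t, 0 ≤ H t
  even : ∀ t, H (-t) = H t
  concave : ConcaveOn ℝ (Icc (-m) m) H
  zero_right : H m = 0
  pos : 0 < H 0

namespace IsAnisotropy

variable {φ : E2 → ℝ}

lemma convexOn (hφ : IsAnisotropy φ) : ConvexOn ℝ univ φ := by
  refine ⟨convex_univ, fun x _ y _ s t hs ht _ => ?_⟩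
  calc φ (s • x + t • y) ≤ φ (s • x) + φ (t • y) := hφ.add_le _ _
    _ = s • φ x + t • φ y := by
      rw [hφ.smul_eq, hφ.smul_eq, abs_of_nonneg hs, abs_of_nonneg ht]; rfl

lemma continuous (hφ : IsAnisotropy φ) : Continuous φ := by
  have := hφ.convexOn.continuousOn isOpen_univ
  rwa [continuousOn_univ] at this

lemma vec2_eq_abs (hs : AxisSymmetric φ) (x y : ℝ) : φ (vec2 x y) = φ (vec2 |x| |y|) := by
  have h1 : ∀ x y, φ (vec2 (-x) y) = φ (vec2 x y) := fun x y => by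
    simpa using (hs (vec2 x y)).1
  have h2 : ∀ x y, φ (vec2 x (-y)) = φ (vec2 x y) := fun x y => by
    simpa using (hs (vec2 x y)).2
  rcases abs_choice x with h | h <;> rcases abs_choice y with h' | h' <;> rw [h, h'] <;>
    simp [h1, h2]

lemma mono_snd (hφ : IsAnisotropy φ) (hs : AxisSymmetric φ) (t : ℝ) {s s' : ℝ}
    (h : |s'| ≤ |s|) : φ (vec2 t s') ≤ φ (vec2 t s) := by
  rcases eq_or_lt_of_le (abs_nonneg s) with h0 | h0
  · have e : s = 0 := by simpa using h0.symm
    have e' : s' = 0 := by rw [e] at h; simpa using h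
    rw [e, e']
  have hc : ConvexOn ℝ univ (fun r => φ (vec2 t r)) := by
    refine ⟨convex_univ, fun x _ y _ u v hu hv huv => ?_⟩
    have := hφ.convexOn.2 (mem_univ (vec2 t x)) (mem_univ (vec2 t y)) hu hv huv
    rw [smul_vec2, smul_vec2, vec2_add] at this
    have e : u * t + v * t = t := by rw [← add_mul, huv, one_mul]
    rw [e] at this
    exact this
  have key := hc.le_max_of_mem_Icc (x := -|s|) (y := |s|) (z := s') (mem_univ _) (mem_univ _)
    (abs_le.1 h)
  have e1 : φ (vec2 t (-|s|)) = φ (vec2 t s) := by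
    rw [vec2_eq_abs hs, vec2_eq_abs hs t s]; simp
  have e2 : φ (vec2 t |s|) = φ (vec2 t s) := by
    rw [vec2_eq_abs hs, vec2_eq_abs hs t s]; simp
  simpa [e1, e2] using key

lemma mono_fst (hφ : IsAnisotropy φ) (hs : AxisSymmetric φ) (s : ℝ) {t t' : ℝ}
    (h : |t'| ≤ |t|) : φ (vec2 t' s) ≤ φ (vec2 t s) := by
  rcases eq_or_lt_of_le (abs_nonneg t) with h0 | h0
  · have e : t = 0 := by simpa using h0.symm
    have e' : t' = 0 := by rw [e] at h; simpa using h
    rw [e, e']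
  have hc : ConvexOn ℝ univ (fun r => φ (vec2 r s)) := by
    refine ⟨convex_univ, fun x _ y _ u v hu hv huv => ?_⟩
    have := hφ.convexOn.2 (mem_univ (vec2 x s)) (mem_univ (vec2 y s)) hu hv huv
    rw [smul_vec2, smul_vec2, vec2_add] at this
    have e : u * s + v * s = s := by rw [← add_mul, huv, one_mul]
    rw [e] at this
    exact this
  have key := hc.le_max_of_mem_Icc (x := -|t|) (y := |t|) (z := t') (mem_univ _) (mem_univ _)
    (abs_le.1 h)
  have e1 : φ (vec2 (-|t|) s) = φ (vec2 t s) := by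
    rw [vec2_eq_abs hs, vec2_eq_abs hs t s]; simp
  have e2 : φ (vec2 |t| s) = φ (vec2 t s) := by
    rw [vec2_eq_abs hs, vec2_eq_abs hs t s]; simp
  simpa [e1, e2] using key

lemma apply_fst (hφ : IsAnisotropy φ) (t : ℝ) : φ (vec2 t 0) = |t| * φ e1 := by
  rw [← hφ.smul_eq, e1, smul_vec2]; simp

lemma apply_snd (hφ : IsAnisotropy φ) (t : ℝ) : φ (vec2 0 t) = |t| * φ e2 := by
  rw [← hφ.smul_eq, e2, smul_vec2]; simp

lemma e1_pos (hφ : IsAnisotropy φ) : 0 < φ e1 := by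
  refine lt_of_le_of_ne (hφ.nonneg _) fun h => ?_
  have := (hφ.eq_zero_iff e1).1 h.symm
  have h2 := congrArg (fun x : E2 => x 0) this
  simp [e1] at h2

lemma e2_pos (hφ : IsAnisotropy φ) : 0 < φ e2 := by
  refine lt_of_le_of_ne (hφ.nonneg _) fun h => ?_
  have := (hφ.eq_zero_iff e2).1 h.symm
  have h2 := congrArg (fun x : E2 => x 1) this
  simp [e2] at h2

lemma wulffWidth_pos (hφ : IsAnisotropy φ) : 0 < wulffWidth φ := inv_pos.2 hφ.e1_pos

lemma abs_fst_le (hφ : IsAnisotropy φ) (hs : AxisSymmetric φ) {t s : ℝ}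
    (h : φ (vec2 t s) ≤ 1) : |t| ≤ wulffWidth φ := by
  have h1 := (hφ.mono_snd hs t (s := s) (s' := 0) (by simp)).trans h
  rw [hφ.apply_fst] at h1
  rwa [wulffWidth, inv_eq_one_div, le_div_iff₀ hφ.e1_pos]

lemma abs_snd_le (hφ : IsAnisotropy φ) (hs : AxisSymmetric φ) {t s : ℝ}
    (h : φ (vec2 t s) ≤ 1) : |s| ≤ (φ e2)⁻¹ := by
  have h1 := (hφ.mono_fst hs s (t := t) (t' := 0) (by simp)).trans h
  rw [hφ.apply_snd] at h1
  rwa [inv_eq_one_div, le_div_iff₀ hφ.e2_pos]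

lemma bddAbove_section (hφ : IsAnisotropy φ) (hs : AxisSymmetric φ) (t : ℝ) :
    BddAbove {s | φ (vec2 t s) ≤ 1} :=
  ⟨(φ e2)⁻¹, fun _ h => (le_abs_self _).trans (hφ.abs_snd_le hs h)⟩

lemma wulffProfile_nonneg (hφ : IsAnisotropy φ) (hs : AxisSymmetric φ) (t : ℝ) :
    0 ≤ wulffProfile φ t := by
  unfold wulffProfile
  rcases Set.eq_empty_or_nonempty {s | φ (vec2 t s) ≤ 1} with h | ⟨s, h⟩
  · rw [h, Real.sSup_empty]
  · exact le_csSup (hφ.bddAbove_section hs t)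
      ((hφ.mono_snd hs t (s := s) (s' := 0) (by simp)).trans h)

lemma vec2_le_one_iff (hφ : IsAnisotropy φ) (hs : AxisSymmetric φ) (t s : ℝ) :
    φ (vec2 t s) ≤ 1 ↔ |t| ≤ wulffWidth φ ∧ |s| ≤ wulffProfile φ t := by
  constructor
  · intro h
    refine ⟨hφ.abs_fst_le hs h, le_csSup (hφ.bddAbove_section hs t) ?_⟩
    exact (hφ.mono_snd hs t (by simp)).trans h
  · rintro ⟨h1, h2⟩
    have hcl : IsClosed {s | φ (vec2 t s) ≤ 1} := by
      refine isClosed_le (hφ.continuous.comp ?_) continuous_const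
      exact (contDiff_vec2 (n := 0)).continuous.comp (by fun_prop : Continuous fun s : ℝ => (t, s))
    have hne : {s | φ (vec2 t s) ≤ 1}.Nonempty := by
      refine ⟨0, ?_⟩
      rw [mem_ofPred_eq, hφ.apply_fst]
      rwa [wulffWidth, inv_eq_one_div, le_div_iff₀ hφ.e1_pos] at h1
    have := hcl.csSup_mem hne (hφ.bddAbove_section hs t)
    refine (hφ.mono_snd hs t ?_).trans this
    exact h2.trans (le_abs_self _)

lemma wulffProfile_eq_zero (hφ : IsAnisotropy φ) (hs : AxisSymmetric φ) (hn : NoVerticalFacets φ)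
    {t : ℝ} (ht : wulffWidth φ ≤ |t|) : wulffProfile φ t = 0 := by
  rcases eq_or_lt_of_le ht with h | h
  · refine le_antisymm (Real.sSup_le (fun s hs' => ?_) le_rfl) (hφ.wulffProfile_nonneg hs t)
    have h1 : φ (vec2 (wulffWidth φ) s) ≤ 1 := by
      rw [mem_ofPred_eq, vec2_eq_abs hs, ← h] at hs'
      rw [vec2_eq_abs hs, abs_of_pos hφ.wulffWidth_pos]
      exact hs'
    have h2 := hn.1 (vec2 (wulffWidth φ) s) h1 fun y hy => by
      have := hφ.abs_fst_le hs (t := y 0) (s := y 1) (by rw [vec2_eta]; exact hy)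
      have := (le_abs_self _).trans this
      simp [PiLp.inner_apply, Fin.sum_univ_two, e1]
      linarith
    have h3 := congrArg (fun x : E2 => x 1) h2
    simp [e1] at h3
    exact h3.le
  · have : {s | φ (vec2 t s) ≤ 1} = ∅ := by
      ext s
      simp only [mem_ofPred_eq, mem_empty_iff_false, iff_false]
      exact fun h' => absurd (hφ.abs_fst_le hs h') (not_le.2 h)
    rw [wulffProfile, this, Real.sSup_empty]

lemma wulffProfile_even (hs : AxisSymmetric φ) (t : ℝ) :
    wulffProfile φ (-t) = wulffProfile φ t := by
  unfold wulffProfile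
  congr 1
  ext s
  rw [mem_ofPred_eq, mem_ofPred_eq, vec2_eq_abs hs, vec2_eq_abs hs t s, abs_neg]

lemma concaveOn_wulffProfile (hφ : IsAnisotropy φ) (hs : AxisSymmetric φ) :
    ConcaveOn ℝ (Icc (-wulffWidth φ) (wulffWidth φ)) (wulffProfile φ) := by
  refine ⟨convex_Icc _ _, fun x hx y hy u v hu hv huv => ?_⟩
  have h1 : φ (vec2 x (wulffProfile φ x)) ≤ 1 := (hφ.vec2_le_one_iff hs _ _).2
    ⟨abs_le.2 hx, by rw [abs_of_nonneg (hφ.wulffProfile_nonneg hs x)]⟩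
  have h2 : φ (vec2 y (wulffProfile φ y)) ≤ 1 := (hφ.vec2_le_one_iff hs _ _).2
    ⟨abs_le.2 hy, by rw [abs_of_nonneg (hφ.wulffProfile_nonneg hs y)]⟩
  have h3 := hφ.convexOn.2 (mem_univ (vec2 x (wulffProfile φ x)))
    (mem_univ (vec2 y (wulffProfile φ y))) hu hv huv
  rw [smul_vec2, smul_vec2, vec2_add] at h3
  have h4 : u • φ (vec2 x (wulffProfile φ x)) + v • φ (vec2 y (wulffProfile φ y)) ≤ 1 := by
    simp only [smul_eq_mul]; nlinarith
  have h5 := ((hφ.vec2_le_one_iff hs _ _).1 (h3.trans h4)).2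
  exact (le_abs_self _).trans h5

lemma continuous_wulffProfile (hφ : IsAnisotropy φ) (hs : AxisSymmetric φ)
    (hn : NoVerticalFacets φ) : Continuous (wulffProfile φ) := by
  rw [continuous_iff_continuousAt]
  intro t
  rcases lt_or_ge |t| (wulffWidth φ) with h | h
  · have h1 := (hφ.concaveOn_wulffProfile hs).subset Ioo_subset_Icc_self (convex_Ioo _ _)
    exact (h1.continuousOn isOpen_Ioo).continuousAt (isOpen_Ioo.mem_nhds (abs_lt.1 h))
  · rw [ContinuousAt, hφ.wulffProfile_eq_zero hs hn h, Metric.tendsto_nhds]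
    intro ε hε
    have h1 : 1 < φ (vec2 t ε) := by
      by_contra! h1
      have := ((hφ.vec2_le_one_iff hs _ _).1 h1).2
      rw [hφ.wulffProfile_eq_zero hs hn h] at this
      exact absurd (abs_nonpos_iff.1 this) hε.ne'
    have hc : Continuous (fun r => φ (vec2 r ε)) := hφ.continuous.comp
      ((contDiff_vec2 (n := 0)).continuous.comp (by fun_prop : Continuous fun r : ℝ => (r, ε)))
    filter_upwards [hc.continuousAt.eventually (lt_mem_nhds h1)] with r hr
    rw [Real.dist_eq, sub_zero, abs_of_nonneg (hφ.wulffProfile_nonneg hs r)]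
    by_contra! h2
    rcases le_or_gt |r| (wulffWidth φ) with h3 | h3
    · exact absurd ((hφ.vec2_le_one_iff hs r ε).2 ⟨h3, by rwa [abs_of_pos hε]⟩) (not_le.2 hr)
    · rw [hφ.wulffProfile_eq_zero hs hn h3.le] at h2
      linarith

lemma isProfile (hφ : IsAnisotropy φ) (hs : AxisSymmetric φ) (hn : NoVerticalFacets φ) :
    IsProfile (wulffWidth φ) (wulffProfile φ) where
  m_pos := hφ.wulffWidth_pos
  cont := hφ.continuous_wulffProfile hs hn
  nonneg := hφ.wulffProfile_nonneg hs
  even := wulffProfile_even hs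
  concave := hφ.concaveOn_wulffProfile hs
  zero_right := hφ.wulffProfile_eq_zero hs hn (le_abs_self _)
  pos := by
    refine (inv_pos.2 hφ.e2_pos).trans_le (le_csSup (hφ.bddAbove_section hs 0) ?_)
    rw [mem_ofPred_eq, hφ.apply_snd, abs_of_pos (inv_pos.2 hφ.e2_pos),
      inv_mul_cancel₀ hφ.e2_pos.ne']

end IsAnisotropy

namespace IsProfile

variable {m : ℝ} {H : ℝ → ℝ}

lemma anti (hH : IsProfile m H) {s t : ℝ} (hst : |s| ≤ |t|) (ht : |t| ≤ m) : H t ≤ H s := by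
  have h1 : |t| ∈ Icc (-m) m := ⟨by linarith [abs_nonneg t, hH.m_pos], ht⟩
  have h2 : -|t| ∈ Icc (-m) m := ⟨by linarith, by linarith [abs_nonneg t, hH.m_pos]⟩
  have h3 : H |t| = H t := by
    rcases abs_choice t with h | h <;> rw [h]
    exact hH.even t
  have := hH.concave.min_le_of_mem_Icc h2 h1 (z := s) (abs_le.1 hst)
  rw [hH.even, min_self, h3] at this
  exact this

lemma le_zero (hH : IsProfile m H) {t : ℝ} (ht : |t| ≤ m) : H t ≤ H 0 :=
  hH.anti (by simp) ht

lemma pos_of_lt (hH : IsProfile m H) {t : ℝ} (ht : |t| < m) : 0 < H t := by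
  have hm := hH.m_pos
  have h1 := hH.concave.2 (⟨by linarith, hm.le⟩ : (0 : ℝ) ∈ Icc (-m) m)
    (⟨by linarith, le_rfl⟩ : m ∈ Icc (-m) m)
    (by rw [sub_nonneg, div_le_one hm]; exact ht.le : 0 ≤ 1 - |t| / m)
    (by positivity : 0 ≤ |t| / m) (by ring)
  simp only [smul_eq_mul, mul_zero, zero_add, hH.zero_right, add_zero] at h1
  rw [div_mul_cancel₀ _ hm.ne'] at h1
  have h2 : 0 < (1 - |t| / m) * H 0 :=
    mul_pos (by rw [sub_pos, div_lt_one hm]; exact ht) hH.pos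
  have h3 : H |t| = H t := by
    rcases abs_choice t with h | h <;> rw [h]
    exact hH.even t
  linarith

/-- Away from the extremal abscissae, the profile has a bounded monotone selection of
(negatives of) supergradients. -/
lemma exists_supergradient (hH : IsProfile m H) {t : ℝ} (ht0 : 0 ≤ t) (ht : t < m) :
    ∃ (ρ : ℝ → ℝ) (C : ℝ), Measurable ρ ∧ 0 ≤ C ∧ (∀ x, |ρ x| ≤ C) ∧
      ∀ x, |x| ≤ t → ∀ y, |y| ≤ m → ρ x * y + H y ≤ ρ x * x + H x := by
  set G : ℝ → ℝ := fun x => -H x with hG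
  have hc : ConvexOn ℝ (Icc (-m) m) G := hH.concave.neg
  set D : ℝ → ℝ := fun x => derivWithin G (Ioi x) x with hD
  have hmono : MonotoneOn D (Ioo (-m) m) := by
    simpa [interior_Icc] using hc.monotoneOn_rightDeriv
  set cl : ℝ → ℝ := fun x => max (-t) (min t x) with hcl
  have hclm : Monotone cl := fun x y h => max_le_max le_rfl (min_le_min le_rfl h)
  have hcl1 : ∀ x, -t ≤ cl x := fun x => le_max_left _ _
  have hcl2 : ∀ x, cl x ≤ t := fun x => max_le (by linarith) (min_le_left _ _)
  have hcl3 : ∀ x, cl x ∈ Ioo (-m) m := fun x =>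
    ⟨by linarith [hcl1 x], by linarith [hcl2 x]⟩
  have hρm : Monotone (fun x => D (cl x)) := fun x y h => hmono (hcl3 x) (hcl3 y) (hclm h)
  have htm : t ∈ Ioo (-m) m := ⟨by linarith, ht⟩
  have htm' : -t ∈ Ioo (-m) m := ⟨by linarith, by linarith⟩
  refine ⟨fun x => D (cl x), max |D (-t)| |D t|, hρm.measurable, by positivity, fun x => ?_,
    fun x hx y hy => ?_⟩
  · have h1 : D (-t) ≤ D (cl x) := hmono htm' (hcl3 x) (hcl1 x)
    have h2 : D (cl x) ≤ D t := hmono (hcl3 x) htm (hcl2 x)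
    exact abs_le_max_abs_abs h1 h2
  · have e : cl x = x := by
      rw [abs_le] at hx
      simp only [hcl]
      rw [min_eq_right hx.2, max_eq_right hx.1]
    simp only [e]
    have hxi : x ∈ interior (Icc (-m) m) := by
      rw [interior_Icc]; exact e ▸ hcl3 x
    have hxS := interior_subset hxi
    have hyS : y ∈ Icc (-m) m := abs_le.1 hy
    rcases lt_trichotomy x y with h | h | h
    · have h1 : D x ≤ slope G x y := hc.rightDeriv_le_slope_of_mem_interior hxi hyS h
      rw [slope_def_field, le_div_iff₀ (by linarith)] at h1
      simp only [hG] at h1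
      linarith
    · rw [h]
    · have h1 := (hc.slope_le_leftDeriv_of_mem_interior hyS hxi h).trans
        (hc.leftDeriv_le_rightDeriv_of_mem_interior hxi)
      change slope G y x ≤ D x at h1
      rw [slope_def_field, div_le_iff₀ (by linarith)] at h1
      simp only [hG] at h1
      linarith

lemma exists_lipschitz (hH : IsProfile m H) {t : ℝ} (ht0 : 0 ≤ t) (ht : t < m) :
    ∃ C, 0 ≤ C ∧ ∀ x y, |x| ≤ t → |y| ≤ t → |H x - H y| ≤ C * |x - y| := by
  obtain ⟨ρ, C, -, hC, hb, hs⟩ := hH.exists_supergradient ht0 ht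
  have key : ∀ x y, |x| ≤ t → |y| ≤ t → H y - H x ≤ C * |x - y| := fun x y hx hy => by
    have h1 := hs x hx y (hy.trans ht.le)
    calc H y - H x ≤ ρ x * (x - y) := by linarith
      _ ≤ |ρ x * (x - y)| := le_abs_self _
      _ = |ρ x| * |x - y| := abs_mul _ _
      _ ≤ C * |x - y| := mul_le_mul_of_nonneg_right (hb x) (abs_nonneg _)
  refine ⟨C, hC, fun x y hx hy => abs_le.2 ⟨?_, ?_⟩⟩
  · linarith [key x y hx hy]
  · have := key y x hy hx
    rw [abs_sub_comm] at this
    exact this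

lemma exists_slope (hH : IsProfile m H) :
    ∃ t₀ q, 0 < t₀ ∧ t₀ < m ∧ 0 < q ∧
      ∀ x y, t₀ ≤ x → x ≤ y → y ≤ m → q * (y - x) ≤ H x - H y := by
  have hm := hH.m_pos
  have h1 : ∀ᶠ t in 𝓝[<] m, H t < H 0 := by
    have := hH.cont.continuousAt (x := m)
    rw [ContinuousAt, hH.zero_right] at this
    exact (this.eventually (gt_mem_nhds hH.pos)).filter_mono nhdsWithin_le_nhds
  have h2 : ∀ᶠ t in 𝓝[<] m, t ∈ Ioo 0 m := Ioo_mem_nhdsLT hm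
  obtain ⟨t, ht, ht0, htm⟩ := (h1.and h2).exists
  refine ⟨t, (H 0 - H t) / t, ht0, htm, div_pos (by linarith) ht0, fun x y hx hxy hy => ?_⟩
  rcases eq_or_lt_of_le hxy with h | h
  · simp [h]
  have hS : ∀ r, 0 ≤ r → r ≤ m → r ∈ Icc (-m) m := fun r h h' => ⟨by linarith, h'⟩
  have ht2 : (H 0 - H t) / t ≤ (H 0 - H x) / x := by
    rcases eq_or_lt_of_le hx with e | e
    · rw [e]
    have := hH.concave.slope_anti_adjacent (hS 0 le_rfl hm.le) (hS x (by linarith) (by linarith))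
      ht0 e
    have h3 : (H t - H 0) * (x - t) ≥ (H x - H t) * t := by
      rw [sub_zero, div_le_div_iff₀ (by linarith) ht0] at this
      linarith
    rw [div_le_div_iff₀ ht0 (by linarith)]
    nlinarith
  have h4 := hH.concave.slope_anti_adjacent (hS 0 le_rfl hm.le) (hS y (by linarith) hy)
      (by linarith : 0 < x) h
  have hx0 : 0 < x := by linarith
  have h5 : (H 0 - H x) / x ≤ (H x - H y) / (y - x) := by
    have e1 : (H x - H 0) / (x - 0) = -((H 0 - H x) / x) := by rw [sub_zero, ← neg_div]; ring_nf
    have e2 : (H y - H x) / (y - x) = -((H x - H y) / (y - x)) := by rw [← neg_div]; ring_nf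
    rw [e1, e2] at h4
    linarith
  exact (le_div_iff₀ (by linarith)).1 (ht2.trans h5)

end IsProfile

/-- A bounded measurable function on the line. -/
def BddMeas (k : ℝ → ℝ) : Prop := Measurable k ∧ ∃ B, ∀ s, |k s| ≤ B

namespace BddMeas

variable {k l : ℝ → ℝ}

lemma add (hk : BddMeas k) (hl : BddMeas l) : BddMeas (fun s => k s + l s) := by
  obtain ⟨hk, B, hB⟩ := hk
  obtain ⟨hl, C, hC⟩ := hl
  exact ⟨hk.add hl, B + C, fun s => (abs_add_le _ _).trans (add_le_add (hB s) (hC s))⟩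

lemma const_mul (hk : BddMeas k) (c : ℝ) : BddMeas (fun s => c * k s) := by
  obtain ⟨hk, B, hB⟩ := hk
  exact ⟨hk.const_mul c, |c| * B, fun s => by
    rw [abs_mul]; exact mul_le_mul_of_nonneg_left (hB s) (abs_nonneg _)⟩

lemma mul (hk : BddMeas k) (hl : BddMeas l) : BddMeas (fun s => k s * l s) := by
  obtain ⟨hk, B, hB⟩ := hk
  obtain ⟨hl, C, hC⟩ := hl
  exact ⟨hk.mul hl, B * C, fun s => by
    rw [abs_mul]
    exact mul_le_mul (hB s) (hC s) (abs_nonneg _) ((abs_nonneg _).trans (hB s))⟩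

lemma neg (hk : BddMeas k) : BddMeas (fun s => -k s) := by
  simpa using hk.const_mul (-1)

lemma sub (hk : BddMeas k) (hl : BddMeas l) : BddMeas (fun s => k s - l s) := by
  simpa [sub_eq_add_neg] using hk.add hl.neg

lemma const (c : ℝ) : BddMeas (fun _ => c) := ⟨measurable_const, |c|, fun _ => le_rfl⟩

lemma integrableOn (hk : BddMeas k) {S : Set ℝ} (hS : volume S ≠ ⊤) : IntegrableOn k S := by
  obtain ⟨hk, B, hB⟩ := hk
  exact Measure.integrableOn_of_bounded hS hk.aestronglyMeasurable
    (M := B) (Eventually.of_forall hB)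

lemma intervalIntegrable (hk : BddMeas k) (a b : ℝ) : IntervalIntegrable k volume a b :=
  ⟨hk.integrableOn (by simp), hk.integrableOn (by simp)⟩

lemma integrable_mul {u : ℝ → ℝ} {S : Set ℝ} (hk : BddMeas k) (hu : IntegrableOn u S) :
    IntegrableOn (fun s => u s * k s) S := by
  obtain ⟨hk, B, hB⟩ := hk
  exact Integrable.mul_bdd (c := B) hu hk.aestronglyMeasurable (Eventually.of_forall hB)

lemma integrable_mul_left {u : ℝ → ℝ} {S : Set ℝ} (hk : BddMeas k) (hu : IntegrableOn u S) :
    IntegrableOn (fun s => k s * u s) S := by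
  simpa only [mul_comm] using hk.integrable_mul hu

end BddMeas

/-- The primitive of `k` vanishing at `a`. -/
def prim (a : ℝ) (k : ℝ → ℝ) (s : ℝ) : ℝ := ∫ r in a..s, k r

section prim

variable {a : ℝ} {k l : ℝ → ℝ}

@[simp] lemma prim_left : prim a k a = 0 := intervalIntegral.integral_same

lemma prim_sub (hk : BddMeas k) (hl : BddMeas l) (s : ℝ) :
    prim a (fun r => k r - l r) s = prim a k s - prim a l s :=
  intervalIntegral.integral_sub (hk.intervalIntegrable _ _) (hl.intervalIntegrable _ _)

lemma prim_const_mul (c s : ℝ) : prim a (fun r => c * k r) s = c * prim a k s :=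
  intervalIntegral.integral_const_mul _ _

lemma prim_neg (s : ℝ) : prim a (fun r => -k r) s = -prim a k s :=
  intervalIntegral.integral_neg

lemma prim_sub_prim (hk : BddMeas k) (s t : ℝ) : prim a k t - prim a k s = ∫ r in s..t, k r :=
  intervalIntegral.integral_interval_sub_left (hk.intervalIntegrable _ _)
    (hk.intervalIntegrable _ _)

lemma abs_prim_sub_le (hk : BddMeas k) {B : ℝ} (hB : ∀ s, |k s| ≤ B) (s t : ℝ) :
    |prim a k t - prim a k s| ≤ B * |t - s| := by
  rw [prim_sub_prim hk, ← Real.norm_eq_abs]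
  exact intervalIntegral.norm_integral_le_of_norm_le_const fun x _ => hB x

lemma continuous_prim (hk : BddMeas k) : Continuous (prim a k) :=
  intervalIntegral.continuous_primitive (fun x y => hk.intervalIntegrable x y) a

lemma abs_prim_le (hk : BddMeas k) {b s : ℝ} (hs : s ∈ Icc a b) :
    |prim a k s| ≤ ∫ r in Ioo a b, |k r| := by
  rw [← integral_Ioc_eq_integral_Ioo]
  calc |prim a k s| ≤ ∫ r in Ioc a s, |k r| := by
        have := intervalIntegral.norm_integral_le_integral_norm (μ := volume) (f := k) hs.1
        rwa [intervalIntegral.integral_of_le hs.1, intervalIntegral.integral_of_le hs.1,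
          ← intervalIntegral.integral_of_le hs.1] at this
    _ ≤ ∫ r in Ioc a b, |k r| := by
        refine setIntegral_mono_set (hk.integrableOn (by simp)).abs
          (Eventually.of_forall fun _ => abs_nonneg _) ?_
        exact (Ioc_subset_Ioc_right hs.2).eventuallyLE

lemma prim_right {b : ℝ} (hab : a ≤ b) : prim a k b = ∫ r in Ioo a b, k r := by
  rw [prim, intervalIntegral.integral_of_le hab, integral_Ioc_eq_integral_Ioo]

lemma ae_deriv_prim (hk : BddMeas k) : ∀ᵐ x, HasDerivAt (prim a k) (k x) x := by
  have : LocallyIntegrable k volume := by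
    intro x
    refine ⟨Icc (x - 1) (x + 1), Icc_mem_nhds (by linarith) (by linarith), ?_⟩
    exact hk.integrableOn (by simp)
  filter_upwards [LocallyIntegrable.ae_hasDerivAt_integral this] with x hx using hx a

/-- Integration by parts for primitives of bounded measurable functions. -/
lemma integral_prim_mul {b : ℝ} (hab : a ≤ b) (hk : BddMeas k) (hl : BddMeas l) :
    ∫ s in Ioo a b, prim a k s * l s =
      prim a k b * prim a l b - ∫ s in Ioo a b, k s * prim a l s := by
  have h1 : AbsolutelyContinuousOnInterval (prim a k) a b :=
    (hk.intervalIntegrable a b).absolutelyContinuousOnInterval_intervalIntegral (by simp)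
  have h2 : AbsolutelyContinuousOnInterval (prim a l) a b :=
    (hl.intervalIntegrable a b).absolutelyContinuousOnInterval_intervalIntegral (by simp)
  have h3 := h1.integral_mul_deriv_eq_deriv_mul h2
  simp only [prim_left, mul_zero, sub_zero] at h3
  rw [intervalIntegral.integral_of_le hab, intervalIntegral.integral_of_le hab,
    integral_Ioc_eq_integral_Ioo, integral_Ioc_eq_integral_Ioo] at h3
  have e1 : ∫ s in Ioo a b, prim a k s * l s = ∫ s in Ioo a b, prim a k s * deriv (prim a l) s := by
    refine integral_congr_ae (ae_restrict_of_ae ?_)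
    filter_upwards [ae_deriv_prim (a := a) hl] with x hx
    rw [hx.deriv]
  have e2 : ∫ s in Ioo a b, k s * prim a l s = ∫ s in Ioo a b, deriv (prim a k) s * prim a l s := by
    refine integral_congr_ae (ae_restrict_of_ae ?_)
    filter_upwards [ae_deriv_prim (a := a) hk] with x hx
    rw [hx.deriv]
  rw [e1, e2, h3]

end prim

lemma exists_cutoff_seq {a b : ℝ} (hab : a < b) :
    ∃ χ : ℕ → ℝ → ℝ, (∀ n, ContDiff ℝ 1 (χ n)) ∧ (∀ n, HasCompactSupport (χ n)) ∧
      (∀ n, tsupport (χ n) ⊆ Ioo a b) ∧ (∀ n s, χ n s ∈ Icc (0 : ℝ) 1) ∧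
      ∀ s ∈ Ioo a b, ∀ᶠ n in atTop, χ n s = 1 := by
  set c := (a + b) / 2 with hc
  set R := (b - a) / 2 with hR
  have hR0 : 0 < R := by rw [hR]; linarith
  have hn : ∀ n : ℕ, (0 : ℝ) < 1 / ((n : ℝ) + 2) ∧ 1 / ((n : ℝ) + 2) < 1 ∧
      1 / ((n : ℝ) + 3) < 1 / ((n : ℝ) + 2) ∧ (0 : ℝ) < 1 / ((n : ℝ) + 3) := fun n => by
    have : (0 : ℝ) ≤ n := Nat.cast_nonneg n
    refine ⟨by positivity, ?_, ?_, by positivity⟩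
    · rw [div_lt_one (by positivity)]; linarith
    · exact one_div_lt_one_div_of_lt (by positivity) (by linarith)
  let f : ℕ → ContDiffBump c := fun n =>
    { rIn := R * (1 - 1 / ((n : ℝ) + 2))
      rOut := R * (1 - 1 / ((n : ℝ) + 3))
      rIn_pos := mul_pos hR0 (by linarith [hn n])
      rIn_lt_rOut := mul_lt_mul_of_pos_left (by linarith [hn n]) hR0 }
  refine ⟨fun n => f n, fun n => (f n).contDiff, fun n => (f n).hasCompactSupport, fun n => ?_,
    fun n s => ⟨(f n).nonneg, (f n).le_one⟩, fun s hs => ?_⟩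
  · rw [(f n).tsupport_eq]
    intro x hx
    rw [Metric.mem_closedBall, Real.dist_eq, abs_le] at hx
    have h1 : R * (1 - 1 / ((n : ℝ) + 3)) < R := by nlinarith [hn n]
    constructor <;> [(have := hx.1); (have := hx.2)] <;> simp only [f] at this <;> linarith
  · have h1 : |s - c| < R := by rw [abs_lt]; constructor <;> linarith [hs.1, hs.2]
    have h2 : Tendsto (fun n : ℕ => R * (1 - 1 / ((n : ℝ) + 2))) atTop (𝓝 (R * (1 - 0))) := by
      refine tendsto_const_nhds.mul (tendsto_const_nhds.sub ?_)
      have := tendsto_one_div_add_atTop_nhds_zero_nat (𝕜 := ℝ)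
      have h3 := (tendsto_add_atTop_iff_nat 1).2 this
      refine h3.congr fun n => ?_
      push_cast; ring
    rw [sub_zero, mul_one] at h2
    filter_upwards [h2.eventually (lt_mem_nhds h1)] with n hn'
    refine (f n).one_of_mem_closedBall ?_
    rw [Metric.mem_closedBall, Real.dist_eq]
    exact hn'.le

lemma exists_continuous_approx {a b : ℝ} (hab : a < b) {k : ℝ → ℝ} (hk : Measurable k) {B : ℝ}
    (hB : ∀ s, |k s| ≤ B) :
    ∃ K : ℕ → ℝ → ℝ, (∀ n, Continuous (K n)) ∧ (∀ n, HasCompactSupport (K n)) ∧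
      (∀ n, tsupport (K n) ⊆ Ioo a b) ∧ (∀ n s, |K n s| ≤ B) ∧
      ∀ᵐ s ∂(volume.restrict (Ioo a b)), Tendsto (fun n => K n s) atTop (𝓝 (k s)) := by
  obtain ⟨χ, hχ1, hχ2, hχ3, hχ4, hχ5⟩ := exists_cutoff_seq hab
  have hB0 : 0 ≤ B := (abs_nonneg _).trans (hB 0)
  set μ := (volume : Measure ℝ).restrict (Ioo a b) with hμ
  have hkL : MemLp k 1 μ := by
    rw [memLp_one_iff_integrable]
    exact BddMeas.integrableOn ⟨hk, B, hB⟩ (by simp)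
  have hex : ∀ n : ℕ, ∃ g : ℝ → ℝ, Continuous g ∧ eLpNorm (k - g) 1 μ ≤ ((n : ℝ≥0∞) + 1)⁻¹ := by
    intro n
    obtain ⟨g, -, h1, h2, -⟩ := hkL.exists_hasCompactSupport_eLpNorm_sub_le (by simp)
      (ε := ((n : ℝ≥0∞) + 1)⁻¹) (by simp)
    exact ⟨g, h2, h1⟩
  choose g hgc hg using hex
  have ht : Tendsto (fun n => eLpNorm (g n - k) 1 μ) atTop (𝓝 0) := by
    refine tendsto_of_tendsto_of_tendsto_of_le_of_le tendsto_const_nhds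
      (h := fun n : ℕ => ((n : ℝ≥0∞) + 1)⁻¹) ?_ (fun _ => zero_le) fun n => ?_
    · have := (tendsto_add_atTop_iff_nat (f := fun n : ℕ => (n : ℝ≥0∞)⁻¹) 1).2
        ENNReal.tendsto_inv_nat_nhds_zero
      simpa using this
    · rw [eLpNorm_sub_comm]; exact hg n
  obtain ⟨ns, -, hns⟩ := (tendstoInMeasure_of_tendsto_eLpNorm one_ne_zero
    (fun n => (hgc n).aestronglyMeasurable) hk.aestronglyMeasurable ht).exists_seq_tendsto_ae
  set cl : ℝ → ℝ := fun x => max (-B) (min B x) with hcl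
  have hclc : Continuous cl := by fun_prop
  have hclb : ∀ x, |cl x| ≤ B := fun x =>
    abs_le.2 ⟨le_max_left _ _, max_le (by linarith) (min_le_left _ _)⟩
  refine ⟨fun n s => χ n s * cl (g (ns n) s), fun n => ?_, fun n => ?_, fun n => ?_,
    fun n s => ?_, ?_⟩
  · exact (hχ1 n).continuous.mul (hclc.comp (hgc _))
  · exact (hχ2 n).mul_right
  · exact (tsupport_mul_subset_left).trans (hχ3 n)
  · rw [abs_mul, abs_of_nonneg (hχ4 n s).1]
    calc χ n s * |cl (g (ns n) s)| ≤ 1 * B :=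
          mul_le_mul (hχ4 n s).2 (hclb _) (abs_nonneg _) zero_le_one
      _ = B := one_mul B
  · filter_upwards [hns, ae_restrict_mem measurableSet_Ioo] with s hs hsI
    have h1 : Tendsto (fun n => cl (g (ns n) s)) atTop (𝓝 (cl (k s))) :=
      (hclc.tendsto _).comp hs
    have h2 : cl (k s) = k s := by
      have := abs_le.1 (hB s)
      simp only [hcl]
      rw [min_eq_right this.2, max_eq_right this.1]
    rw [h2] at h1
    refine h1.congr' ?_
    filter_upwards [hχ5 s hsI] with n hn
    rw [hn, one_mul]

lemma integral_le_toReal_aniArea {φ : E2 → ℝ} {u : ℝ → ℝ} {J : Set ℝ} (hA : aniArea φ u J ≠ ⊤)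
    {h₁ h₂ : ℝ → ℝ} (h1 : ContDiff ℝ 1 h₁) (h2 : ContDiff ℝ 1 h₂) (h3 : HasCompactSupport h₁)
    (h4 : HasCompactSupport h₂) (h5 : tsupport h₁ ⊆ J) (h6 : tsupport h₂ ⊆ J)
    (h7 : ∀ s ∈ J, φ (vec2 (h₁ s) (h₂ s)) ≤ 1) :
    ∫ s in J, (u s * deriv h₁ s + h₂ s) ≤ (aniArea φ u J).toReal := by
  rw [← ENNReal.ofReal_le_iff_le_toReal hA, aniArea]
  exact le_iSup_of_le h₁ <| le_iSup_of_le h₂ <| le_iSup_of_le h1 <| le_iSup_of_le h2 <|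
    le_iSup_of_le h3 <| le_iSup_of_le h4 <| le_iSup_of_le h5 <| le_iSup_of_le h6 <|
    le_iSup_of_le h7 le_rfl

section lowerBound

variable {φ : E2 → ℝ} {m : ℝ} {H : ℝ → ℝ} {u : ℝ → ℝ} {a b : ℝ}

lemma IsProfile.bddMeas_comp (hH : IsProfile m H) {h : ℝ → ℝ} (hm : Measurable h)
    (hb : ∀ s, |h s| ≤ m) : BddMeas (fun s => H (h s)) :=
  ⟨hH.cont.measurable.comp hm, H 0, fun s => by
    rw [abs_of_nonneg (hH.nonneg _)]; exact hH.le_zero (hb s)⟩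

lemma IsProfile.integrableOn_comp (hH : IsProfile m H) {h : ℝ → ℝ} (hc : Continuous h)
    (a b : ℝ) : IntegrableOn (fun s => H (h s)) (Ioo a b) :=
  ((hH.cont.comp hc).continuousOn.integrableOn_Icc (a := a) (b := b)).mono_set Ioo_subset_Icc_self

lemma integral_add_profile_le_of_contDiff (hab : a < b) (hH : IsProfile m H)
    (hW : ∀ t s, φ (vec2 t s) ≤ 1 ↔ |t| ≤ m ∧ |s| ≤ H t)
    (hu : IntegrableOn u (Ioo a b)) (hA : aniArea φ u (Ioo a b) ≠ ⊤)
    {h : ℝ → ℝ} (h1 : ContDiff ℝ 1 h) (h2 : HasCompactSupport h) (h3 : tsupport h ⊆ Ioo a b)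
    {t : ℝ} (ht0 : 0 ≤ t) (ht : t < m) (hht : ∀ s ∈ Icc a b, |h s| ≤ t) :
    (∫ s in Ioo a b, u s * deriv h s) + ∫ s in Ioo a b, H (h s) ≤
      (aniArea φ u (Ioo a b)).toReal := by
  obtain ⟨χ, hχ1, hχ2, hχ3, hχ4, hχ5⟩ := exists_cutoff_seq hab
  have hdb : BddMeas (deriv h) := by
    have hc : Continuous (deriv h) := h1.continuous_deriv le_rfl
    obtain ⟨C, hC⟩ := hc.bounded_above_of_compact_support h2.deriv
    exact ⟨hc.measurable, C, hC⟩
  have hint := hdb.integrable_mul hu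
  have hHint := hH.integrableOn_comp h1.continuous a b
  have hc0 : 0 < H t := hH.pos_of_lt (by rwa [abs_of_nonneg ht0])
  have hlow : ∀ s ∈ Icc a b, H t ≤ H (h s) := fun s hs =>
    hH.anti (by rw [abs_of_nonneg ht0]; exact hht s hs) (by rw [abs_of_nonneg ht0]; exact ht.le)
  have hsub := Ioo_subset_Icc_self (a := a) (b := b)
  have key : ∀ ε ∈ Ioo 0 (H t / 2), (∫ s in Ioo a b, u s * deriv h s) +
      ∫ s in Ioo a b, H (h s) ≤ (aniArea φ u (Ioo a b)).toReal + 2 * ε * (b - a) := by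
    intro ε hε
    obtain ⟨P, hP⟩ := exists_polynomial_near_of_continuousOn a b (fun s => H (h s) - ε)
      ((hH.cont.comp h1.continuous).sub continuous_const).continuousOn ε hε.1
    have hPc : ContDiff ℝ 1 (fun s => P.eval s) := by
      simpa [Polynomial.coe_aeval_eq_eval] using P.contDiff_aeval (𝕜 := ℝ) 1
    have hPint : IntegrableOn (fun s => P.eval s) (Ioo a b) :=
      (hPc.continuous.continuousOn.integrableOn_Icc (a := a) (b := b)).mono_set hsub
    have hP1 : ∀ s ∈ Icc a b, 0 ≤ P.eval s ∧ P.eval s ≤ H (h s) ∧ H (h s) - 2 * ε ≤ P.eval s :=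
      fun s hs => by
        have h4 := abs_lt.1 (hP s hs)
        have h5 := hlow s hs
        refine ⟨?_, ?_, ?_⟩ <;> linarith [h4.1, h4.2, hε.2]
    have hn : ∀ n, (∫ s in Ioo a b, u s * deriv h s) + ∫ s in Ioo a b, χ n s * P.eval s ≤
        (aniArea φ u (Ioo a b)).toReal := by
      intro n
      have h6 : IntegrableOn (fun s => χ n s * P.eval s) (Ioo a b) :=
        (((hχ1 n).continuous.mul hPc.continuous).continuousOn.integrableOn_Icc
          (a := a) (b := b)).mono_set hsub
      rw [← integral_add hint h6]
      refine integral_le_toReal_aniArea hA h1 ((hχ1 n).mul hPc) h2 (hχ2 n).mul_right h3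
        (tsupport_mul_subset_left.trans (hχ3 n)) fun s hs => ?_
      rw [hW]
      have h7 := hP1 s (hsub hs)
      have h8 := hχ4 n s
      refine ⟨(hht s (hsub hs)).trans ht.le, ?_⟩
      rw [abs_of_nonneg (mul_nonneg h8.1 h7.1)]
      calc χ n s * P.eval s ≤ 1 * P.eval s := mul_le_mul_of_nonneg_right h8.2 h7.1
        _ ≤ H (h s) := by rw [one_mul]; exact h7.2.1
    have hlim : Tendsto (fun n => ∫ s in Ioo a b, χ n s * P.eval s) atTop
        (𝓝 (∫ s in Ioo a b, P.eval s)) := by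
      refine tendsto_integral_of_dominated_convergence (fun s => |P.eval s|) (fun n => ?_)
        hPint.abs (fun n => Eventually.of_forall fun s => ?_) ?_
      · exact ((hχ1 n).continuous.mul hPc.continuous).aestronglyMeasurable
      · rw [Real.norm_eq_abs, abs_mul, abs_of_nonneg (hχ4 n s).1]
        exact mul_le_of_le_one_left (abs_nonneg _) (hχ4 n s).2
      · filter_upwards [ae_restrict_mem measurableSet_Ioo] with s hs
        refine tendsto_const_nhds.congr' ?_
        filter_upwards [hχ5 s hs] with n hn
        rw [hn, one_mul]
    have h9 := le_of_tendsto (hlim.const_add (∫ s in Ioo a b, u s * deriv h s))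
      (Eventually.of_forall hn)
    have h10 : ∫ s in Ioo a b, H (h s) ≤ (∫ s in Ioo a b, P.eval s) + 2 * ε * (b - a) := by
      have h11 : ∫ s in Ioo a b, H (h s) ≤ ∫ s in Ioo a b, (P.eval s + 2 * ε) := by
        refine setIntegral_mono_on hHint (hPint.add (integrable_const _)) measurableSet_Ioo
          fun s hs => ?_
        linarith [(hP1 s (hsub hs)).2.2]
      rw [integral_add hPint (integrable_const _)] at h11
      simp only [integral_const, smul_eq_mul, measureReal_restrict_apply_univ,
        Real.volume_real_Ioo_of_le hab.le] at h11
      linarith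
    linarith
  have hlim : Tendsto (fun ε : ℝ => (aniArea φ u (Ioo a b)).toReal + 2 * ε * (b - a)) (𝓝[>] 0)
      (𝓝 ((aniArea φ u (Ioo a b)).toReal + 2 * 0 * (b - a))) := by
    refine Tendsto.mono_left (Continuous.tendsto ?_ 0) nhdsWithin_le_nhds
    fun_prop
  rw [mul_zero, zero_mul, add_zero] at hlim
  refine ge_of_tendsto hlim ?_
  filter_upwards [Ioo_mem_nhdsGT (show 0 < H t / 2 by linarith)] with ε hε using key ε hε

lemma contDiff_prim {k : ℝ → ℝ} (hk : Continuous k) :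
    ContDiff ℝ 1 (prim a k) ∧ deriv (prim a k) = k := by
  have h1 : ∀ x, HasDerivAt (prim a k) (k x) x := fun x =>
    intervalIntegral.integral_hasDerivAt_right (hk.intervalIntegrable _ _)
      (hk.stronglyMeasurableAtFilter _ _) hk.continuousAt
  have h2 : deriv (prim a k) = k := funext fun x => (h1 x).deriv
  refine ⟨?_, h2⟩
  rw [contDiff_one_iff_deriv, h2]
  exact ⟨fun x => (h1 x).differentiableAt, hk⟩

lemma tsupport_prim_subset (hab : a < b) {k : ℝ → ℝ} (hkb : BddMeas k) (hk : HasCompactSupport k)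
    (hs : tsupport k ⊆ Ioo a b) (h0 : prim a k b = 0) :
    HasCompactSupport (prim a k) ∧ tsupport (prim a k) ⊆ Ioo a b := by
  obtain ⟨a', b', ha', hb', hsub⟩ : ∃ a' b', a < a' ∧ b' < b ∧ tsupport k ⊆ Icc a' b' := by
    rcases (tsupport k).eq_empty_or_nonempty with h | h
    · exact ⟨b, a, hab, hab, by simp [h]⟩
    · refine ⟨sInf (tsupport k), sSup (tsupport k), (hs (hk.isCompact.sInf_mem h)).1,
        (hs (hk.isCompact.sSup_mem h)).2, fun x hx => ?_⟩
      exact ⟨csInf_le hk.isCompact.bddBelow hx, le_csSup hk.isCompact.bddAbove hx⟩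
  have hk0 : ∀ x, x ∉ Icc a' b' → k x = 0 := fun x hx =>
    image_eq_zero_of_notMem_tsupport fun h => hx (hsub h)
  have h1 : ∀ s, s ∉ Icc a' b' → prim a k s = 0 := by
    intro s hs'
    rcases lt_or_ge s a' with h | h
    · refine intervalIntegral.integral_zero_ae (Eventually.of_forall fun x hx => hk0 x ?_)
      have : x ≤ max a s := hx.2
      exact fun h' => absurd h'.1 (not_le.2 (this.trans_lt (max_lt ha' h)))
    · have h2 : b' < s := by
        by_contra! h3
        exact hs' ⟨h, h3⟩
      have h3 : prim a k s - prim a k b = 0 := by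
        rw [prim_sub_prim hkb]
        refine intervalIntegral.integral_zero_ae (Eventually.of_forall fun x hx => hk0 x ?_)
        have : min b s < x := hx.1
        exact fun h' => absurd h'.2 (not_le.2 ((lt_min hb' h2).trans this))
      linarith
  have h2 : tsupport (prim a k) ⊆ Icc a' b' := by
    refine closure_minimal (fun x hx => ?_) isClosed_Icc
    by_contra h
    exact hx (h1 x h)
  exact ⟨HasCompactSupport.of_support_subset_isCompact isCompact_Icc
    (subset_closure.trans h2), h2.trans fun x hx => ⟨ha'.trans_le hx.1, hx.2.trans_lt hb'⟩⟩

lemma exists_unit_bump (hab : a < b) :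
    ∃ β : ℝ → ℝ, Continuous β ∧ HasCompactSupport β ∧ tsupport β ⊆ Ioo a b ∧
      ∫ s in Ioo a b, β s = 1 := by
  let f : ContDiffBump ((a + b) / 2) :=
    { rIn := (b - a) / 8
      rOut := (b - a) / 4
      rIn_pos := by linarith
      rIn_lt_rOut := by linarith }
  have hs : tsupport (f.normed volume) ⊆ Ioo a b := by
    rw [f.tsupport_normed_eq]
    intro x hx
    rw [Metric.mem_closedBall, Real.dist_eq, abs_le] at hx
    constructor <;> [(have := hx.1); (have := hx.2)] <;> simp only [f] at this <;> linarith
  refine ⟨f.normed volume, f.continuous_normed, f.hasCompactSupport_normed, hs, ?_⟩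
  rw [setIntegral_eq_integral_of_forall_compl_eq_zero, f.integral_normed]
  exact fun x hx => image_eq_zero_of_notMem_tsupport fun h => hx (hs h)

lemma integral_add_profile_le_of_lt (hab : a < b) (hH : IsProfile m H)
    (hW : ∀ t s, φ (vec2 t s) ≤ 1 ↔ |t| ≤ m ∧ |s| ≤ H t)
    (hu : IntegrableOn u (Ioo a b)) (hA : aniArea φ u (Ioo a b) ≠ ⊤)
    {k : ℝ → ℝ} (hk : BddMeas k) (h0 : prim a k b = 0)
    {t : ℝ} (ht0 : 0 ≤ t) (ht : t < m) (hht : ∀ s ∈ Icc a b, |prim a k s| ≤ t) :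
    (∫ s in Ioo a b, u s * k s) + ∫ s in Ioo a b, H (prim a k s) ≤
      (aniArea φ u (Ioo a b)).toReal := by
  obtain ⟨B, hB⟩ := hk.2
  obtain ⟨K, hK1, hK2, hK3, hK4, hK5⟩ := exists_continuous_approx hab hk.1 hB
  obtain ⟨β, hβ1, hβ2, hβ3, hβ4⟩ := exists_unit_bump hab
  have hβb : BddMeas β := by
    obtain ⟨C, hC⟩ := hβ1.bounded_above_of_compact_support hβ2
    exact ⟨hβ1.measurable, C, hC⟩
  have hKb : ∀ n, BddMeas (K n) := fun n => ⟨(hK1 n).measurable, B, hK4 n⟩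
  have hsub := Ioo_subset_Icc_self (a := a) (b := b)
  set c : ℕ → ℝ := fun n => ∫ s in Ioo a b, K n s with hc
  have hclim : Tendsto c atTop (𝓝 0) := by
    rw [← h0, prim_right hab.le]
    exact tendsto_integral_of_dominated_convergence (fun _ => B)
      (fun n => (hK1 n).aestronglyMeasurable) (integrable_const _)
      (fun n => Eventually.of_forall (hK4 n)) hK5
  set l : ℕ → ℝ → ℝ := fun n s => K n s - c n * β s with hl
  have hlc : ∀ n, Continuous (l n) := fun n => (hK1 n).sub (continuous_const.mul hβ1)
  have hlb : ∀ n, BddMeas (l n) := fun n => (hKb n).sub (hβb.const_mul (c n))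
  have hls : ∀ n, tsupport (l n) ⊆ tsupport (K n) ∪ tsupport β := fun n => by
    refine closure_minimal (fun x hx => ?_) ((isClosed_tsupport _).union (isClosed_tsupport _))
    by_contra h
    rw [mem_union, not_or] at h
    refine hx ?_
    simp only [hl]
    rw [image_eq_zero_of_notMem_tsupport h.1, image_eq_zero_of_notMem_tsupport h.2]
    ring
  have hlcs : ∀ n, HasCompactSupport (l n) := fun n =>
    ((hK2 n).isCompact.union hβ2.isCompact).of_isClosed_subset (isClosed_tsupport _) (hls n)
  have hl0 : ∀ n, prim a (l n) b = 0 := fun n => by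
    rw [prim_right hab.le]
    simp only [hl]
    rw [integral_sub ((hKb n).integrableOn (by simp))
      ((hβb.const_mul (c n)).integrableOn (by simp)), integral_const_mul, hβ4]
    simp [hc]
  have hllim : ∀ᵐ s ∂(volume.restrict (Ioo a b)), Tendsto (fun n => l n s) atTop (𝓝 (k s)) := by
    filter_upwards [hK5] with s hs
    have := hs.sub (hclim.mul_const (β s))
    simpa using this
  obtain ⟨C, hC⟩ := hβb.2
  have hC0 : 0 ≤ C := (abs_nonneg _).trans (hC 0)
  have hlB : ∀ᶠ n in atTop, ∀ s, |l n s| ≤ B + C := by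
    have : ∀ᶠ n in atTop, |c n| < 1 := by
      have := hclim.abs
      rw [abs_zero] at this
      exact this.eventually (gt_mem_nhds one_pos)
    filter_upwards [this] with n hn s
    calc |l n s| ≤ |K n s| + |c n * β s| := abs_sub _ _
      _ ≤ B + 1 * C := by
        rw [abs_mul]
        exact add_le_add (hK4 n s) (mul_le_mul hn.le (hC s) (abs_nonneg _) zero_le_one)
      _ = B + C := by ring
  have hL1 : Tendsto (fun n => ∫ s in Ioo a b, |l n s - k s|) atTop (𝓝 0) := by
    have : Tendsto (fun n => ∫ s in Ioo a b, |l n s - k s|) atTop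
        (𝓝 (∫ s in Ioo a b, (0 : ℝ))) := by
      refine tendsto_integral_filter_of_dominated_convergence (fun _ => B + C + B)
        (Eventually.of_forall fun n => ((hlb n).sub hk).1.abs.aestronglyMeasurable) ?_
        (integrable_const _) ?_
      · filter_upwards [hlB] with n hn
        refine Eventually.of_forall fun s => ?_
        rw [Real.norm_eq_abs, abs_abs]
        exact (abs_sub _ _).trans (add_le_add (hn s) (hB s))
      · filter_upwards [hllim] with s hs
        have := (hs.sub_const (k s)).abs
        simpa using this
    simpa using this
  have hdiff : ∀ n, ∀ s ∈ Icc a b, |prim a (l n) s - prim a k s| ≤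
      ∫ r in Ioo a b, |l n r - k r| := fun n s hs => by
    rw [← prim_sub (hlb n) hk]
    exact abs_prim_le ((hlb n).sub hk) hs
  set t' := (t + m) / 2 with ht'
  have hbd : ∀ᶠ n in atTop, ∀ s ∈ Icc a b, |prim a (l n) s| ≤ t' := by
    filter_upwards [hL1.eventually (gt_mem_nhds (show 0 < t' - t by rw [ht']; linarith))]
      with n hn s hs
    have h1 := hdiff n s hs
    have h2 := hht s hs
    have h3 := abs_sub_abs_le_abs_sub (prim a (l n) s) (prim a k s)
    linarith
  have hn : ∀ᶠ n in atTop, (∫ s in Ioo a b, u s * l n s) +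
      ∫ s in Ioo a b, H (prim a (l n) s) ≤ (aniArea φ u (Ioo a b)).toReal := by
    filter_upwards [hbd] with n hn
    obtain ⟨h1, h2⟩ := contDiff_prim (a := a) (hlc n)
    obtain ⟨h3, h4⟩ := tsupport_prim_subset hab (hlb n) (hlcs n)
      ((hls n).trans (union_subset (hK3 n) hβ3)) (hl0 n)
    have := integral_add_profile_le_of_contDiff hab hH hW hu hA h1 h3 h4
      (t := t') (by rw [ht']; linarith) (by rw [ht']; linarith) hn
    rwa [h2] at this
  have hlim1 : Tendsto (fun n => ∫ s in Ioo a b, u s * l n s) atTop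
      (𝓝 (∫ s in Ioo a b, u s * k s)) := by
    refine tendsto_integral_filter_of_dominated_convergence (fun s => |u s| * (B + C))
      (Eventually.of_forall fun n => ((hlb n).integrable_mul hu).aestronglyMeasurable) ?_
      (hu.abs.mul_const _) ?_
    · filter_upwards [hlB] with n hn
      refine Eventually.of_forall fun s => ?_
      rw [Real.norm_eq_abs, abs_mul]
      exact mul_le_mul_of_nonneg_left (hn s) (abs_nonneg _)
    · filter_upwards [hllim] with s hs using hs.const_mul _
  have hlim2 : Tendsto (fun n => ∫ s in Ioo a b, H (prim a (l n) s)) atTop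
      (𝓝 (∫ s in Ioo a b, H (prim a k s))) := by
    refine tendsto_integral_filter_of_dominated_convergence (fun _ => H 0)
      (Eventually.of_forall fun n =>
        (hH.cont.comp (continuous_prim (hlb n))).aestronglyMeasurable) ?_
      (integrable_const _) ?_
    · filter_upwards [hbd] with n hn
      filter_upwards [ae_restrict_mem measurableSet_Ioo] with s hs
      rw [Real.norm_eq_abs, abs_of_nonneg (hH.nonneg _)]
      exact hH.le_zero ((hn s (hsub hs)).trans (by rw [ht']; linarith))
    · filter_upwards [ae_restrict_mem measurableSet_Ioo] with s hs
      refine (hH.cont.tendsto _).comp ?_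
      rw [tendsto_iff_dist_tendsto_zero]
      exact squeeze_zero (fun _ => dist_nonneg) (fun n => hdiff n s (hsub hs)) hL1
  exact le_of_tendsto (hlim1.add hlim2) hn

lemma IsProfile.tendsto_integral_comp_mul (hH : IsProfile m H) {h : ℝ → ℝ} (hc : Continuous h)
    (hm : ∀ s ∈ Icc a b, |h s| ≤ m) :
    Tendsto (fun δ : ℝ => ∫ s in Ioo a b, H ((1 - δ) * h s)) (𝓝[>] 0)
      (𝓝 (∫ s in Ioo a b, H (h s))) := by
  refine tendsto_integral_filter_of_dominated_convergence (fun _ => H 0)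
    (Eventually.of_forall fun δ => (hH.cont.comp
      (continuous_const.mul hc)).aestronglyMeasurable) ?_
    (integrable_const _) (Eventually.of_forall fun s => ?_)
  · filter_upwards [Ioo_mem_nhdsGT (zero_lt_one' ℝ)] with δ hδ
    filter_upwards [ae_restrict_mem measurableSet_Ioo] with s hs
    rw [Real.norm_eq_abs, abs_of_nonneg (hH.nonneg _)]
    refine hH.le_zero ?_
    rw [abs_mul, abs_of_nonneg (by linarith [hδ.2] : (0 : ℝ) ≤ 1 - δ)]
    exact (mul_le_of_le_one_left (abs_nonneg _) (by linarith [hδ.1])).trans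
      (hm s (Ioo_subset_Icc_self hs))
  · have : Continuous fun δ : ℝ => H ((1 - δ) * h s) := hH.cont.comp (by fun_prop)
    have h2 := this.tendsto 0
    simp only [sub_zero, one_mul] at h2
    exact h2.mono_left nhdsWithin_le_nhds

/-- The anisotropic area may be tested with Lipschitz functions vanishing at the boundary. -/
lemma integral_add_profile_le (hab : a < b) (hH : IsProfile m H)
    (hW : ∀ t s, φ (vec2 t s) ≤ 1 ↔ |t| ≤ m ∧ |s| ≤ H t)
    (hu : IntegrableOn u (Ioo a b)) (hA : aniArea φ u (Ioo a b) ≠ ⊤)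
    {k : ℝ → ℝ} (hk : BddMeas k) (h0 : prim a k b = 0)
    (hkm : ∀ s ∈ Icc a b, |prim a k s| ≤ m) :
    (∫ s in Ioo a b, u s * k s) + ∫ s in Ioo a b, H (prim a k s) ≤
      (aniArea φ u (Ioo a b)).toReal := by
  have hm := hH.m_pos
  have key : ∀ δ ∈ Ioo (0 : ℝ) 1, (1 - δ) * (∫ s in Ioo a b, u s * k s) +
      ∫ s in Ioo a b, H ((1 - δ) * prim a k s) ≤ (aniArea φ u (Ioo a b)).toReal := by
    intro δ hδ
    have h1 := integral_add_profile_le_of_lt hab hH hW hu hA (hk.const_mul (1 - δ))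
      (by rw [prim_const_mul, h0, mul_zero]) (t := (1 - δ) * m)
      (mul_nonneg (by linarith [hδ.2]) hm.le) (by nlinarith [hδ.1]) (fun s hs => by
        rw [prim_const_mul, abs_mul, abs_of_nonneg (by linarith [hδ.2] : (0 : ℝ) ≤ 1 - δ)]
        exact mul_le_mul_of_nonneg_left (hkm s hs) (by linarith [hδ.2]))
    simp only [prim_const_mul] at h1
    have e : ∫ s in Ioo a b, u s * ((1 - δ) * k s) = (1 - δ) * ∫ s in Ioo a b, u s * k s := by
      rw [← integral_const_mul]
      congr 1
      ext s
      ring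
    rwa [e] at h1
  have hlim1 : Tendsto (fun δ : ℝ => (1 - δ) * (∫ s in Ioo a b, u s * k s)) (𝓝[>] 0)
      (𝓝 ((1 - 0) * (∫ s in Ioo a b, u s * k s))) :=
    Tendsto.mono_left (Continuous.tendsto (by fun_prop) 0) nhdsWithin_le_nhds
  have hlim2 := hH.tendsto_integral_comp_mul (continuous_prim hk) hkm
  rw [sub_zero, one_mul] at hlim1
  refine le_of_tendsto (hlim1.add hlim2) ?_
  filter_upwards [Ioo_mem_nhdsGT (zero_lt_one' ℝ)] with δ hδ using key δ hδ

end lowerBound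

lemma aniArea_congr {φ : E2 → ℝ} {u v : ℝ → ℝ} {J : Set ℝ}
    (h : ∀ᵐ s ∂(volume.restrict J), u s = v s) : aniArea φ u J = aniArea φ v J := by
  have key : ∀ h₁ h₂ : ℝ → ℝ, ∫ s in J, (u s * deriv h₁ s + h₂ s) =
      ∫ s in J, (v s * deriv h₁ s + h₂ s) := fun h₁ h₂ => by
    refine integral_congr_ae ?_
    filter_upwards [h] with s hs
    rw [hs]
  simp only [aniArea, key]

lemma bddMeas_deriv {h : ℝ → ℝ} (h1 : ContDiff ℝ 1 h) (h2 : HasCompactSupport h) :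
    BddMeas (deriv h) := by
  have hc : Continuous (deriv h) := h1.continuous_deriv le_rfl
  obtain ⟨C, hC⟩ := hc.bounded_above_of_compact_support h2.deriv
  exact ⟨hc.measurable, C, hC⟩

lemma integrableOn_of_contDiff {h : ℝ → ℝ} (h1 : ContDiff ℝ 1 h) (h2 : HasCompactSupport h)
    (J : Set ℝ) : IntegrableOn h J :=
  (h1.continuous.integrable_of_hasCompactSupport h2).integrableOn

/-- Convexity of the anisotropic area. -/
lemma aniArea_convex {φ : E2 → ℝ} {u v : ℝ → ℝ} {J : Set ℝ} (hu : IntegrableOn u J)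
    (hv : IntegrableOn v J) (hAu : aniArea φ u J ≠ ⊤) (hAv : aniArea φ v J ≠ ⊤) {r t : ℝ}
    (hr : 0 ≤ r) (ht : 0 ≤ t) (hrt : r + t = 1) :
    aniArea φ (fun s => r * u s + t * v s) J ≤
      ENNReal.ofReal (r * (aniArea φ u J).toReal + t * (aniArea φ v J).toReal) := by
  conv_lhs => rw [aniArea]
  refine iSup_le fun h₁ => iSup_le fun h₂ => iSup_le fun h1 => iSup_le fun h2 => iSup_le fun h3 =>
    iSup_le fun h4 => iSup_le fun h5 => iSup_le fun h6 => iSup_le fun h7 => ?_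
  refine ENNReal.ofReal_le_ofReal ?_
  have hd := bddMeas_deriv h1 h3
  have hi := integrableOn_of_contDiff h2 h4 J
  have e : ∫ s in J, ((r * u s + t * v s) * deriv h₁ s + h₂ s) =
      r * (∫ s in J, (u s * deriv h₁ s + h₂ s)) + t * ∫ s in J, (v s * deriv h₁ s + h₂ s) := by
    have i1 : IntegrableOn (fun s => r * (u s * deriv h₁ s + h₂ s)) J :=
      ((hd.integrable_mul hu).add hi).const_mul r
    have i2 : IntegrableOn (fun s => t * (v s * deriv h₁ s + h₂ s)) J :=
      ((hd.integrable_mul hv).add hi).const_mul t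
    rw [← integral_const_mul, ← integral_const_mul, ← integral_add i1 i2]
    congr 1
    ext s
    have : h₂ s = (r + t) * h₂ s := by rw [hrt, one_mul]
    linear_combination this
  rw [e]
  exact add_le_add
    (mul_le_mul_of_nonneg_left (integral_le_toReal_aniArea hAu h1 h2 h3 h4 h5 h6 h7) hr)
    (mul_le_mul_of_nonneg_left (integral_le_toReal_aniArea hAv h1 h2 h3 h4 h5 h6 h7) ht)

lemma aniArea_sub_prim_le {φ : E2 → ℝ} {a b : ℝ} (hab : a < b) (c : ℝ) {y R : ℝ → ℝ}
    (hy : BddMeas y) (hR : IntegrableOn R (Ioo a b))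
    (h : ∀ s ∈ Ioo a b, ∀ x₁ x₂, φ (vec2 x₁ x₂) ≤ 1 → y s * x₁ + x₂ ≤ R s) :
    aniArea φ (fun s => c - prim a y s) (Ioo a b) ≤ ENNReal.ofReal (∫ s in Ioo a b, R s) := by
  rw [aniArea]
  refine iSup_le fun h₁ => iSup_le fun h₂ => iSup_le fun h1 => iSup_le fun h2 => iSup_le fun h3 =>
    iSup_le fun h4 => iSup_le fun h5 => iSup_le fun h6 => iSup_le fun h7 => ?_
  refine ENNReal.ofReal_le_ofReal ?_
  have hd := bddMeas_deriv h1 h3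
  have hi := integrableOn_of_contDiff h2 h4 (Ioo a b)
  have hz : ∀ x, x ∉ Ioo a b → h₁ x = 0 := fun x hx =>
    image_eq_zero_of_notMem_tsupport fun h => hx (h5 h)
  have hp : ∀ s, prim a (deriv h₁) s = h₁ s := fun s => by
    rw [prim, intervalIntegral.integral_deriv_eq_sub
      (fun x _ => (h1.differentiable one_ne_zero).differentiableAt) (hd.intervalIntegrable _ _),
      hz a (by simp), sub_zero]
  have hpi : IntegrableOn (prim a y) (Ioo a b) :=
    ((continuous_prim hy).continuousOn.integrableOn_Icc (a := a) (b := b)).mono_set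
      Ioo_subset_Icc_self
  have h8 : ∫ s in Ioo a b, deriv h₁ s = 0 := by
    rw [← prim_right hab.le, hp, hz b (by simp)]
  have hyh : IntegrableOn (fun s => y s * h₁ s) (Ioo a b) :=
    hy.integrable_mul_left (integrableOn_of_contDiff h1 h3 _)
  have e : ∫ s in Ioo a b, ((c - prim a y s) * deriv h₁ s + h₂ s) =
      ∫ s in Ioo a b, (y s * h₁ s + h₂ s) := by
    have h9 := integral_prim_mul hab.le hy hd
    simp only [hp] at h9
    rw [hz b (by simp), mul_zero, zero_sub] at h9
    have i1 : IntegrableOn (fun s => (c - prim a y s) * deriv h₁ s) (Ioo a b) :=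
      hd.integrable_mul ((integrable_const c).sub hpi)
    rw [integral_add i1 hi, integral_add hyh hi]
    congr 1
    simp only [sub_mul]
    rw [integral_sub ((hd.integrableOn (by simp)).const_mul c) (hd.integrable_mul hpi),
      integral_const_mul, h8, h9]
    ring
  rw [e]
  exact setIntegral_mono_on (hyh.add hi) hR measurableSet_Ioo fun s hs => h s hs _ _ (h7 s hs)

section trapezoid

variable {a c d : ℝ}

lemma bddMeas_indicator_one {S : Set ℝ} (hS : MeasurableSet S) :
    BddMeas (S.indicator fun _ => (1 : ℝ)) :=
  ⟨measurable_const.indicator hS, 1, fun s => by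
    by_cases h : s ∈ S <;> simp [h]⟩

lemma prim_indicator_Ioc (hac : a ≤ c) {s : ℝ} (hs : a ≤ s) :
    prim a ((Ioc c d).indicator fun _ => (1 : ℝ)) s = max 0 (min s d - c) := by
  rw [prim, intervalIntegral.integral_of_le hs, setIntegral_indicator measurableSet_Ioc]
  have : Ioc a s ∩ Ioc c d = Ioc c (min s d) := by
    rw [Ioc_inter_Ioc, sup_eq_right.2 hac]
  rw [this]
  simp only [integral_const, smul_eq_mul, mul_one, measureReal_restrict_apply_univ,
    Real.volume_real_Ioc]
  exact max_comm _ _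

/-- The slope of the trapezoidal function rising on `(x, x + δ]` and descending on
`(y, y + δ]`. -/
def trapSlope (δ x y s : ℝ) : ℝ :=
  δ⁻¹ * ((Ioc x (x + δ)).indicator (fun _ => (1 : ℝ)) s -
    (Ioc y (y + δ)).indicator (fun _ => (1 : ℝ)) s)

variable {δ x y : ℝ}

lemma bddMeas_trapSlope : BddMeas (trapSlope δ x y) :=
  ((bddMeas_indicator_one measurableSet_Ioc).sub
    (bddMeas_indicator_one measurableSet_Ioc)).const_mul _

lemma abs_trapSlope_le (hδ : 0 < δ) (s : ℝ) : |trapSlope δ x y s| ≤ δ⁻¹ := by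
  rw [trapSlope, abs_mul, abs_of_pos (inv_pos.2 hδ)]
  refine mul_le_of_le_one_right (inv_pos.2 hδ).le ?_
  by_cases h1 : s ∈ Ioc x (x + δ) <;> by_cases h2 : s ∈ Ioc y (y + δ) <;> simp [h1, h2]

lemma prim_trapSlope (hδ : 0 < δ) (hx : a ≤ x) (hxy : x + δ ≤ y) {s : ℝ} (hs : a ≤ s) :
    prim a (trapSlope δ x y) s =
      δ⁻¹ * (max 0 (min s (x + δ) - x) - max 0 (min s (y + δ) - y)) := by
  unfold trapSlope
  rw [prim_const_mul, prim_sub (bddMeas_indicator_one measurableSet_Ioc)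
    (bddMeas_indicator_one measurableSet_Ioc), prim_indicator_Ioc hx hs,
    prim_indicator_Ioc (by linarith) hs]

lemma prim_trapSlope_mem (hδ : 0 < δ) (hx : a ≤ x) (hxy : x + δ ≤ y) {s : ℝ} (hs : a ≤ s) :
    prim a (trapSlope δ x y) s ∈ Icc (0 : ℝ) 1 := by
  rw [prim_trapSlope hδ hx hxy hs, mem_Icc, ← div_eq_inv_mul, le_div_iff₀ hδ, div_le_one hδ]
  constructor
  · rcases le_total s y with h | h
    · have : min s (y + δ) - y ≤ 0 := by linarith [min_le_left s (y + δ)]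
      rw [max_eq_left this]; simp
    · rw [min_eq_right (a := s) (b := x + δ) (by linarith)]
      have : min s (y + δ) - y ≤ δ := by linarith [min_le_right s (y + δ)]
      have h2 := max_le hδ.le this
      have h3 := le_max_right 0 (x + δ - x)
      linarith
  · have := le_max_left 0 (min s (y + δ) - y)
    have h2 : max 0 (min s (x + δ) - x) ≤ δ := max_le hδ.le (by linarith [min_le_right s (x + δ)])
    linarith

lemma prim_trapSlope_eq_one (hδ : 0 < δ) (hx : a ≤ x) (hxy : x + δ ≤ y) {s : ℝ}
    (hs : s ∈ Icc (x + δ) y) : prim a (trapSlope δ x y) s = 1 := by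
  rw [prim_trapSlope hδ hx hxy (by linarith [hs.1]), min_eq_right hs.1,
    max_eq_left (b := min s (y + δ) - y) (by linarith [hs.2, min_le_left s (y + δ)]),
    max_eq_right (by linarith)]
  field_simp
  ring

lemma prim_trapSlope_eq_zero (hδ : 0 < δ) (hx : a ≤ x) (hxy : x + δ ≤ y) {s : ℝ} (has : a ≤ s)
    (hs : s ≤ x ∨ y + δ ≤ s) : prim a (trapSlope δ x y) s = 0 := by
  rw [prim_trapSlope hδ hx hxy has]
  rcases hs with hs | hs
  · rw [max_eq_left (by linarith [min_le_left s (x + δ)]),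
      max_eq_left (by linarith [min_le_left s (y + δ)])]
    simp
  · rw [min_eq_right hs, min_eq_right (by linarith)]
    simp

end trapezoid

lemma rpow_sub_rpow_le {p R x y : ℝ} (hp : 1 ≤ p) (hx : 0 ≤ x) (hy : 0 ≤ y) (hxR : x ≤ R) :
    x ^ p - y ^ p ≤ p * R ^ (p - 1) * |x - y| := by
  have hR : 0 ≤ R := hx.trans hxR
  have h0 : 0 ≤ p * R ^ (p - 1) := mul_nonneg (by linarith) (Real.rpow_nonneg hR _)
  rcases le_or_gt x y with h | h
  · have := Real.rpow_le_rpow hx h (by linarith : 0 ≤ p)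
    have := mul_nonneg h0 (abs_nonneg (x - y))
    linarith
  · have hx0 : 0 < x := hy.trans_lt h
    have h1 := one_add_mul_self_le_rpow_one_add (s := y / x - 1)
      (by linarith [div_nonneg hy hx]) hp
    rw [add_sub_cancel, Real.div_rpow hy hx, le_div_iff₀ (Real.rpow_pos_of_pos hx0 p)] at h1
    have h2 : x ^ p = x ^ (p - 1) * x := by
      rw [← Real.rpow_add_one hx0.ne']; ring_nf
    have h3 : x ^ p - y ^ p ≤ p * x ^ (p - 1) * (x - y) := by
      have : (1 + p * (y / x - 1)) * x ^ p = x ^ p - p * x ^ (p - 1) * (x - y) := by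
        rw [h2]; field_simp; ring
      linarith
    rw [abs_of_pos (by linarith)]
    refine h3.trans (mul_le_mul_of_nonneg_right (mul_le_mul_of_nonneg_left ?_ (by linarith))
      (by linarith))
    exact Real.rpow_le_rpow hx hxR (by linarith)

lemma le_add_rpow_mul_rpow {p δ t : ℝ} (hp : 1 ≤ p) (hδ : 0 < δ) (ht : 0 ≤ t) :
    t ≤ δ + δ ^ (1 - p) * t ^ p := by
  have h0 := mul_nonneg (Real.rpow_nonneg hδ.le (1 - p)) (Real.rpow_nonneg ht p)
  rcases le_or_gt t δ with h | h
  · linarith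
  · have ht0 : 0 < t := hδ.trans h
    have h1 : t ^ (1 - p) * t ^ p = t := by
      rw [← Real.rpow_add ht0, sub_add_cancel, Real.rpow_one]
    have h2 : t ^ (1 - p) ≤ δ ^ (1 - p) :=
      Real.rpow_le_rpow_of_nonpos hδ h.le (by linarith)
    have h3 := mul_le_mul_of_nonneg_right h2 (Real.rpow_nonneg ht p)
    linarith

lemma Gfun_eq_ofReal {φ : E2 → ℝ} {p : ℝ} {g v : ℝ → ℝ} {I : Set ℝ} (hA : aniArea φ v I ≠ ⊤)
    (hi : IntegrableOn (fun s => |v s - g s| ^ p) I) :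
    Gfun φ p g I v = ENNReal.ofReal ((aniArea φ v I).toReal + ∫ s in I, |v s - g s| ^ p) := by
  have hnn : ∀ s, 0 ≤ |v s - g s| ^ p := fun s => Real.rpow_nonneg (abs_nonneg _) _
  rw [Gfun, ENNReal.ofReal_add ENNReal.toReal_nonneg (integral_nonneg hnn),
    ENNReal.ofReal_toReal hA, ofReal_integral_eq_lintegral_ofReal hi (Eventually.of_forall hnn)]

lemma integrableOn_rpow_of_bdd {p B : ℝ} (hp : 0 ≤ p) {w : ℝ → ℝ} {a b : ℝ}
    (hw : AEStronglyMeasurable w (volume.restrict (Ioo a b)))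
    (hB : ∀ᵐ s ∂(volume.restrict (Ioo a b)), |w s| ≤ B) :
    IntegrableOn (fun s => |w s| ^ p) (Ioo a b) := by
  refine Integrable.of_bound ((Real.continuous_rpow_const hp).comp_aestronglyMeasurable hw.norm)
    (B ^ p) ?_
  filter_upwards [hB] with s hs
  rw [Real.norm_of_nonneg (Real.rpow_nonneg (abs_nonneg _) _)]
  exact Real.rpow_le_rpow (abs_nonneg _) hs hp

section minimizer

variable {φ : E2 → ℝ} {m : ℝ} {H : ℝ → ℝ} {u g : ℝ → ℝ} {a b p : ℝ}

lemma aniArea_const_le (hab : a < b) (hH : IsProfile m H)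
    (hW : ∀ t s, φ (vec2 t s) ≤ 1 ↔ |t| ≤ m ∧ |s| ≤ H t) (c : ℝ) :
    aniArea φ (fun _ => c) (Ioo a b) ≤ ENNReal.ofReal (H 0 * (b - a)) := by
  have h := aniArea_sub_prim_le (φ := φ) hab c (y := fun _ => 0) (R := fun _ => H 0)
    (BddMeas.const 0) (integrable_const _) fun s _ x₁ x₂ hx => by
      rw [hW] at hx
      linarith [le_abs_self x₂, hx.2, hH.le_zero hx.1]
  simpa [prim, Real.volume_real_Ioo_of_le hab.le, mul_comm] using h

lemma le_toReal_aniArea (hab : a < b) (hH : IsProfile m H)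
    (hW : ∀ t s, φ (vec2 t s) ≤ 1 ↔ |t| ≤ m ∧ |s| ≤ H t)
    (hu : IntegrableOn u (Ioo a b)) (hA : aniArea φ u (Ioo a b) ≠ ⊤) :
    H 0 * (b - a) ≤ (aniArea φ u (Ioo a b)).toReal := by
  have h := integral_add_profile_le hab hH hW hu hA (k := fun _ => 0) (BddMeas.const 0)
    (by simp [prim]) (by simp [prim, hH.m_pos.le])
  simpa [prim, Real.volume_real_Ioo_of_le hab.le, mul_comm] using h

lemma IsMinimizerG.energy_estimates (hab : a < b) (hH : IsProfile m H)
    (hW : ∀ t s, φ (vec2 t s) ≤ 1 ↔ |t| ≤ m ∧ |s| ≤ H t) (hp : 1 ≤ p) {σ : ℝ} (hσ : 0 < σ)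
    (hg : AEStronglyMeasurable g (volume.restrict (Ioo a b)))
    (hgσ : ∀ᵐ s ∂(volume.restrict (Ioo a b)), |g s| ≤ σ)
    (hmin : IsMinimizerG φ p g (Ioo a b) u) :
    aniArea φ u (Ioo a b) ≠ ⊤ ∧
      (aniArea φ u (Ioo a b)).toReal ≤ (H 0 + σ ^ p) * (b - a) ∧
      ∫ s in Ioo a b, |u s| ≤ 3 * σ * (b - a) := by
  have hp0 : 0 ≤ p := by linarith
  have hc := aniArea_const_le hab hH hW 0
  have hc' : aniArea φ (fun _ => 0) (Ioo a b) ≠ ⊤ := ne_top_of_le_ne_top (by simp) hc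
  have hg' : ∀ᵐ s ∂(volume.restrict (Ioo a b)), |(0 : ℝ) - g s| ≤ σ := by
    filter_upwards [hgσ] with s hs
    rwa [zero_sub, abs_neg]
  have hi0 := integrableOn_rpow_of_bdd hp0 (aestronglyMeasurable_const.sub hg) hg'
  have h0 := hmin.2 (fun _ => 0) (integrable_const _)
  simp only [Pi.sub_apply] at hi0
  rw [Gfun_eq_ofReal (v := fun _ => 0) hc' hi0] at h0
  have hA : aniArea φ u (Ioo a b) ≠ ⊤ :=
    ne_top_of_le_ne_top (by simp) (le_self_add.trans h0)
  have hum := hmin.1.aestronglyMeasurable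
  have hl : ∫⁻ s in Ioo a b, ENNReal.ofReal (|u s - g s| ^ p) ≠ ⊤ :=
    ne_top_of_le_ne_top (by simp) (le_add_self.trans h0)
  have hi : IntegrableOn (fun s => |u s - g s| ^ p) (Ioo a b) := by
    refine ⟨(Real.continuous_rpow_const hp0).comp_aestronglyMeasurable (hum.sub hg).norm, ?_⟩
    rw [hasFiniteIntegral_iff_ofReal
      (Eventually.of_forall fun s => Real.rpow_nonneg (abs_nonneg _) _)]
    exact hl.lt_top
  have hR : ∫ s in Ioo a b, |(0 : ℝ) - g s| ^ p ≤ σ ^ p * (b - a) := by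
    have : ∫ s in Ioo a b, |(0 : ℝ) - g s| ^ p ≤ ∫ s in Ioo a b, σ ^ p := by
      refine integral_mono_ae hi0 (integrable_const _) ?_
      filter_upwards [hg'] with s hs
      exact Real.rpow_le_rpow (abs_nonneg _) hs hp0
    simpa [Real.volume_real_Ioo_of_le hab.le, mul_comm] using this
  have hc2 : (aniArea φ (fun _ => 0) (Ioo a b)).toReal ≤ H 0 * (b - a) :=
    ENNReal.toReal_le_of_le_ofReal (mul_nonneg (hH.nonneg 0) (by linarith)) hc
  rw [Gfun_eq_ofReal hA hi, ENNReal.ofReal_le_ofReal_iff (add_nonneg ENNReal.toReal_nonneg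
    (integral_nonneg fun s => Real.rpow_nonneg (abs_nonneg _) _))] at h0
  have hlow := le_toReal_aniArea hab hH hW hmin.1 hA
  have hnn : 0 ≤ ∫ s in Ioo a b, |u s - g s| ^ p :=
    integral_nonneg fun s => Real.rpow_nonneg (abs_nonneg _) _
  refine ⟨hA, by linarith, ?_⟩
  have hle : ∫ s in Ioo a b, |u s| ≤
      ∫ s in Ioo a b, (2 * σ + σ ^ (1 - p) * |u s - g s| ^ p) := by
    refine integral_mono_ae hmin.1.abs ((integrable_const _).add (hi.const_mul _)) ?_
    filter_upwards [hgσ] with s hs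
    have h1 := le_add_rpow_mul_rpow hp hσ (abs_nonneg (u s - g s))
    have h2 := abs_sub_abs_le_abs_sub (u s) (g s)
    linarith
  rw [integral_add (integrable_const _) (hi.const_mul _),
    integral_const_mul (σ ^ (1 - p))] at hle
  have h3 : σ ^ (1 - p) * (∫ s in Ioo a b, |u s - g s| ^ p) ≤ σ * (b - a) := by
    calc _ ≤ σ ^ (1 - p) * (σ ^ p * (b - a)) :=
          mul_le_mul_of_nonneg_left (by linarith) (Real.rpow_nonneg hσ.le _)
      _ = σ * (b - a) := by
          rw [← mul_assoc, ← Real.rpow_add hσ, sub_add_cancel, Real.rpow_one]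
  have h4 : ∫ _ in Ioo a b, 2 * σ = 2 * σ * (b - a) := by
    simp [Real.volume_real_Ioo_of_le hab.le, mul_comm]
  linarith

lemma ae_le_of_forall_integral_mul_le (hab : a < b) (hm : 0 < m) (hum : Measurable u)
    (hu : IntegrableOn u (Ioo a b)) {α K : ℝ}
    (h : ∀ k, BddMeas k → ∫ s in Ioo a b, k s = 0 → ∫ s in Ioo a b, |k s| ≤ m →
      ∫ s in Ioo a b, u s * k s ≤ α)
    (hK : (∫ s in Ioo a b, |u s|) / (b - a) + 2 * α / m < K) :
    ∀ᵐ s ∂(volume.restrict (Ioo a b)), u s ≤ K := by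
  set S : Set ℝ := {s | K < u s} with hS
  have hSm : MeasurableSet S := measurableSet_lt measurable_const hum
  have hl : 0 < b - a := by linarith
  set V : ℝ := volume.real (S ∩ Ioo a b) with hV
  have hVfin : volume (S ∩ Ioo a b) ≠ ⊤ := measure_ne_top_of_subset inter_subset_right (by simp)
  have hVi : ∫ s in Ioo a b, S.indicator (fun _ => (1 : ℝ)) s = V := by
    rw [integral_indicator hSm]
    simp [hV, measureReal_restrict_apply hSm]
  rcases (measureReal_nonneg (μ := volume) (s := S ∩ Ioo a b)).eq_or_lt with h0 | hV0
  · rw [ae_iff]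
    simp only [not_le]
    rw [Measure.restrict_apply hSm]
    exact (measureReal_eq_zero_iff hVfin).1 h0.symm
  exfalso
  change 0 < V at hV0
  have hSb : BddMeas (S.indicator fun _ => (1 : ℝ)) := bddMeas_indicator_one hSm
  have hkb := (hSb.sub (BddMeas.const (V / (b - a)))).const_mul (m / (2 * V))
  have hSi : IntegrableOn (S.indicator fun _ => (1 : ℝ)) (Ioo a b) := hSb.integrableOn (by simp)
  have hci : ∀ c : ℝ, ∫ _ in Ioo a b, c = c * (b - a) := fun c => by
    simp [Real.volume_real_Ioo_of_le hab.le, mul_comm]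
  have h1 := h _ hkb (by
    rw [integral_const_mul, integral_sub hSi (integrable_const _), hVi, hci]
    field_simp
    ring) (by
    have : ∫ s in Ioo a b, |m / (2 * V) * (S.indicator (fun _ => (1 : ℝ)) s - V / (b - a))| ≤
        ∫ s in Ioo a b, m / (2 * V) * (S.indicator (fun _ => (1 : ℝ)) s + V / (b - a)) := by
      refine integral_mono (hkb.integrableOn (by simp)).abs
        ((hSi.add (integrable_const _)).const_mul _) fun s => ?_
      simp only
      rw [abs_mul, abs_of_pos (by positivity : 0 < m / (2 * V))]
      refine mul_le_mul_of_nonneg_left ((abs_sub _ _).trans ?_) (by positivity)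
      rw [abs_of_pos (by positivity : 0 < V / (b - a)), abs_of_nonneg]
      exact indicator_nonneg (fun _ _ => zero_le_one) _
    rw [integral_const_mul, integral_add hSi (integrable_const _), hVi, hci] at this
    refine this.trans_eq ?_
    field_simp
    ring)
  have e : ∫ s in Ioo a b, u s * (m / (2 * V) * (S.indicator (fun _ => (1 : ℝ)) s - V / (b - a)))
      = m / (2 * V) * ((∫ s in Ioo a b, u s * S.indicator (fun _ => (1 : ℝ)) s) -
        V / (b - a) * ∫ s in Ioo a b, u s) := by
    rw [← integral_const_mul, ← integral_sub (hSb.integrable_mul hu) (hu.const_mul _),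
      ← integral_const_mul]
    congr 1
    ext s
    ring
  rw [e] at h1
  have h2 : K * V ≤ ∫ s in Ioo a b, u s * S.indicator (fun _ => (1 : ℝ)) s := by
    rw [← hVi, ← integral_const_mul]
    refine integral_mono (hSi.const_mul _) (hSb.integrable_mul hu) fun s => ?_
    by_cases hs : s ∈ S
    · simp only [indicator_of_mem hs, mul_one]
      exact (show K < u s from hs).le
    · simp [indicator_of_notMem hs]
  have h3 : ∫ s in Ioo a b, u s ≤ ∫ s in Ioo a b, |u s| :=
    integral_mono hu hu.abs fun s => le_abs_self _
  have h4 : m / (2 * V) * (K * V - V / (b - a) * ∫ s in Ioo a b, |u s|) ≤ α := by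
    refine le_trans (mul_le_mul_of_nonneg_left ?_ (by positivity)) h1
    have := mul_le_mul_of_nonneg_left h3 (by positivity : 0 ≤ V / (b - a))
    linarith
  have h5 : m / (2 * V) * (K * V - V / (b - a) * ∫ s in Ioo a b, |u s|) =
      m / 2 * (K - (∫ s in Ioo a b, |u s|) / (b - a)) := by
    field_simp
  rw [h5] at h4
  have h6 : m / 2 * (2 * α / m) < m / 2 * (K - (∫ s in Ioo a b, |u s|) / (b - a)) :=
    mul_lt_mul_of_pos_left (by linarith) (by positivity)
  have h7 : m / 2 * (2 * α / m) = α := by field_simp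
  linarith

lemma integral_mul_le_toReal_aniArea (hab : a < b) (hH : IsProfile m H)
    (hW : ∀ t s, φ (vec2 t s) ≤ 1 ↔ |t| ≤ m ∧ |s| ≤ H t)
    (hu : IntegrableOn u (Ioo a b)) (hA : aniArea φ u (Ioo a b) ≠ ⊤)
    {k : ℝ → ℝ} (hk : BddMeas k) (h0 : ∫ s in Ioo a b, k s = 0)
    (hkm : ∫ s in Ioo a b, |k s| ≤ m) :
    ∫ s in Ioo a b, u s * k s ≤ (aniArea φ u (Ioo a b)).toReal := by
  have h1 := integral_add_profile_le hab hH hW hu hA hk (by rw [prim_right hab.le, h0])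
    fun s hs => (abs_prim_le hk hs).trans hkm
  have h2 : 0 ≤ ∫ s in Ioo a b, H (prim a k s) := integral_nonneg fun s => hH.nonneg _
  linarith

lemma ae_abs_le_of_aniArea (hab : a < b) (hH : IsProfile m H)
    (hW : ∀ t s, φ (vec2 t s) ≤ 1 ↔ |t| ≤ m ∧ |s| ≤ H t) (hum : Measurable u)
    (hu : IntegrableOn u (Ioo a b)) (hA : aniArea φ u (Ioo a b) ≠ ⊤) {K : ℝ}
    (hK : (∫ s in Ioo a b, |u s|) / (b - a) + 2 * (aniArea φ u (Ioo a b)).toReal / m < K) :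
    ∀ᵐ s ∂(volume.restrict (Ioo a b)), |u s| ≤ K := by
  have h1 := ae_le_of_forall_integral_mul_le hab hH.m_pos hum hu
    (fun k hk h0 hkm => integral_mul_le_toReal_aniArea hab hH hW hu hA hk h0 hkm) hK
  have h2 := ae_le_of_forall_integral_mul_le hab hH.m_pos hum.neg hu.neg
    (α := (aniArea φ u (Ioo a b)).toReal) (K := K) (fun k hk h0 hkm => by
      have := integral_mul_le_toReal_aniArea hab hH hW hu hA hk.neg
        (by rw [integral_neg, h0, neg_zero]) (by simpa using hkm)
      simpa using this) (by simpa using hK)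
  filter_upwards [h1, h2] with s hs1 hs2
  exact abs_le.2 ⟨by simp only [Pi.neg_apply] at hs2; linarith, hs1⟩

/-- A bounded minimizer is, up to an `L¹` penalty, a minimizer of the anisotropic area. -/
lemma IsMinimizerG.toReal_aniArea_le (hp : 1 ≤ p)
    (hg : AEStronglyMeasurable g (volume.restrict (Ioo a b)))
    (hg1 : ∀ᵐ s ∂(volume.restrict (Ioo a b)), |g s| ≤ 1)
    (hmin : IsMinimizerG φ p g (Ioo a b) u) (hub : BddMeas u) {K : ℝ} (huK : ∀ s, |u s| ≤ K)
    (hA : aniArea φ u (Ioo a b) ≠ ⊤) {v : ℝ → ℝ} (hv : BddMeas v)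
    (hAv : aniArea φ v (Ioo a b) ≠ ⊤) :
    (aniArea φ u (Ioo a b)).toReal ≤ (aniArea φ v (Ioo a b)).toReal +
      p * (K + 2) ^ (p - 1) * ∫ s in Ioo a b, |v s - u s| := by
  have hp0 : 0 ≤ p := by linarith
  obtain ⟨B, hB⟩ := (hv.sub hub).2
  have hB0 : 0 ≤ B := (abs_nonneg _).trans (hB 0)
  set t : ℝ := (B + 1)⁻¹ with ht
  have ht0 : 0 < t := by positivity
  have ht1 : t ≤ 1 := inv_le_one_of_one_le₀ (by linarith)
  have htB : t * B ≤ 1 := by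
    rw [ht, inv_mul_le_iff₀ (by linarith)]; linarith
  set w : ℝ → ℝ := fun s => (1 - t) * u s + t * v s with hw
  have hwu : ∀ s, w s = u s + t * (v s - u s) := fun s => by simp only [hw]; ring
  have hui : IntegrableOn u (Ioo a b) := hub.integrableOn (by simp)
  have hvi : IntegrableOn v (Ioo a b) := hv.integrableOn (by simp)
  have hwb : BddMeas w := (hub.const_mul _).add (hv.const_mul _)
  have hwi : IntegrableOn w (Ioo a b) := hwb.integrableOn (by simp)
  have hAw := aniArea_convex hui hvi hA hAv (by linarith : 0 ≤ 1 - t) ht0.le (by ring)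
  have hAw' : aniArea φ w (Ioo a b) ≠ ⊤ := ne_top_of_le_ne_top (by simp) hAw
  have hAw2 := ENNReal.toReal_le_of_le_ofReal (add_nonneg (mul_nonneg (by linarith : 0 ≤ 1 - t)
    ENNReal.toReal_nonneg) (mul_nonneg ht0.le ENNReal.toReal_nonneg)) hAw
  have hwg : ∀ᵐ s ∂(volume.restrict (Ioo a b)), |w s - g s| ≤ K + 2 := by
    filter_upwards [hg1] with s hs
    have h1 : |t * (v s - u s)| ≤ 1 := by
      rw [abs_mul, abs_of_pos ht0]
      exact (mul_le_mul_of_nonneg_left (hB s) ht0.le).trans htB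
    have h2 : |w s| ≤ K + 1 := by
      rw [hwu]; exact (abs_add_le _ _).trans (add_le_add (huK s) h1)
    exact (abs_sub _ _).trans (by linarith)
  have hug : ∀ᵐ s ∂(volume.restrict (Ioo a b)), |u s - g s| ≤ K + 1 := by
    filter_upwards [hg1] with s hs
    exact (abs_sub _ _).trans (by linarith [huK s])
  have hi1 := integrableOn_rpow_of_bdd hp0 (hub.1.aestronglyMeasurable.sub hg) hug
  have hi2 := integrableOn_rpow_of_bdd hp0 (hwb.1.aestronglyMeasurable.sub hg) hwg
  simp only [Pi.sub_apply] at hi1 hi2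
  have hG := hmin.2 w hwi
  rw [Gfun_eq_ofReal hA hi1, Gfun_eq_ofReal hAw' hi2, ENNReal.ofReal_le_ofReal_iff (add_nonneg
    ENNReal.toReal_nonneg (integral_nonneg fun s => Real.rpow_nonneg (abs_nonneg _) _))] at hG
  have hint : (∫ s in Ioo a b, |w s - g s| ^ p) - ∫ s in Ioo a b, |u s - g s| ^ p ≤
      p * (K + 2) ^ (p - 1) * (t * ∫ s in Ioo a b, |v s - u s|) := by
    rw [← integral_sub hi2 hi1, ← integral_const_mul, ← integral_const_mul]
    refine integral_mono_ae (hi2.sub hi1) ((((hvi.sub hui).abs).const_mul _).const_mul _) ?_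
    filter_upwards [hwg] with s hs
    refine (rpow_sub_rpow_le hp (abs_nonneg _) (abs_nonneg _) hs).trans ?_
    refine mul_le_mul_of_nonneg_left ?_ (mul_nonneg hp0
      (Real.rpow_nonneg ((abs_nonneg _).trans hs) _))
    refine (abs_abs_sub_abs_le _ _).trans_eq ?_
    rw [hwu, show u s + t * (v s - u s) - g s - (u s - g s) = t * (v s - u s) by ring, abs_mul,
      abs_of_pos ht0]
  have hfin : t * (aniArea φ u (Ioo a b)).toReal ≤ t * ((aniArea φ v (Ioo a b)).toReal +
      p * (K + 2) ^ (p - 1) * ∫ s in Ioo a b, |v s - u s|) := by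
    linarith
  exact le_of_mul_le_mul_left hfin ht0

end minimizer

section duality

lemma inner_Lp_two_eq_integral {μ : Measure ℝ} (f w : Lp ℝ 2 μ) {v : ℝ → ℝ} (h : w =ᵐ[μ] v) :
    ⟪f, w⟫ = ∫ s, f s * v s ∂μ := by
  rw [L2.inner_def]
  refine integral_congr_ae ?_
  filter_upwards [h] with s hs
  rw [hs]
  simp [mul_comm]
variable {μ : Measure ℝ} [IsFiniteMeasure μ]

lemma BddMeas.memLp {k : ℝ → ℝ} (hk : BddMeas k) : MemLp k 2 μ := by
  obtain ⟨hk, B, hB⟩ := hk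
  exact MemLp.of_bound hk.aestronglyMeasurable B (Eventually.of_forall hB)

lemma integrable_Lp_two (w : Lp ℝ 2 μ) : Integrable w μ :=
  (Lp.memLp w).integrable one_le_two

lemma continuous_integral_abs_Lp_two : Continuous fun w : Lp ℝ 2 μ => ∫ s, |w s| ∂μ := by
  have h1 : MemLp (fun _ : ℝ => (1 : ℝ)) 2 μ := (BddMeas.const 1).memLp
  have h2 : (fun w : Lp ℝ 2 μ => ∫ s, |w s| ∂μ) = fun w => ⟪|w|, h1.toLp⟫ := by
    ext w
    rw [inner_Lp_two_eq_integral _ _ h1.coeFn_toLp]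
    refine integral_congr_ae ?_
    filter_upwards [Lp.coeFn_abs w] with s hs
    rw [hs, mul_one]
  rw [h2]
  refine Continuous.inner ?_ continuous_const
  exact continuous_id.sup continuous_id.neg

lemma integral_abs_Lp_two_smul_add (x y : Lp ℝ 2 μ) {r t : ℝ} (hr : 0 ≤ r) (ht : 0 ≤ t) :
    ∫ s, |(r • x + t • y : Lp ℝ 2 μ) s| ∂μ ≤ r * ∫ s, |x s| ∂μ + t * ∫ s, |y s| ∂μ := by
  have hx := (integrable_Lp_two x).abs.const_mul r
  have hy := (integrable_Lp_two y).abs.const_mul t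
  rw [← integral_const_mul, ← integral_const_mul, ← integral_add hx hy]
  refine integral_mono_ae (integrable_Lp_two _).abs (hx.add hy) ?_
  filter_upwards [Lp.coeFn_add (r • x) (t • y), Lp.coeFn_smul r x, Lp.coeFn_smul t y]
    with s h1 h2 h3
  rw [h1, Pi.add_apply, h2, h3]
  simp only [Pi.smul_apply, smul_eq_mul]
  refine (abs_add_le _ _).trans_eq ?_
  rw [abs_mul, abs_mul, abs_of_nonneg hr, abs_of_nonneg ht]

lemma exists_bddMeas_repr {f : Lp ℝ 2 μ} {L : ℝ} (hL : 0 ≤ L)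
    (h : ∀ w : Lp ℝ 2 μ, ⟪f, w⟫ ≤ L * ∫ s, |w s| ∂μ) :
    ∃ f' : ℝ → ℝ, BddMeas f' ∧ (∀ s, |f' s| ≤ L) ∧ f =ᵐ[μ] f' := by
  have key : ∀ θ : ℝ, |θ| = 1 → ∀ S : Set ℝ, MeasurableSet S →
      ∫ s in S, θ * f s ∂μ ≤ ∫ _ in S, L ∂μ := by
    intro θ hθ S hS
    have hb : BddMeas (S.indicator fun _ => θ) := by
      refine ⟨measurable_const.indicator hS, 1, fun s => ?_⟩
      by_cases hs : s ∈ S <;> simp [hs, hθ]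
    have h1 := h (hb.memLp (μ := μ)).toLp
    have h2 := (hb.memLp (μ := μ)).coeFn_toLp
    rw [inner_Lp_two_eq_integral _ _ h2] at h1
    have e1 : ∫ s, f s * S.indicator (fun _ => θ) s ∂μ = ∫ s in S, θ * f s ∂μ := by
      rw [← integral_indicator hS]
      congr 1
      ext s
      by_cases hs : s ∈ S <;> simp [hs, mul_comm]
    have e2 : L * ∫ s, |(hb.memLp (μ := μ)).toLp _ s| ∂μ = ∫ _ in S, L ∂μ := by
      rw [← integral_indicator hS, ← integral_const_mul]
      refine integral_congr_ae ?_
      filter_upwards [h2] with s hs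
      rw [hs]
      by_cases hs : s ∈ S <;> simp [hs, hθ]
    rwa [e1, e2] at h1
  have hf := integrable_Lp_two f
  have h1 := ae_le_of_forall_setIntegral_le (hf.const_mul 1) (integrable_const L)
    fun S hS _ => key 1 (by simp) S hS
  have h2 := ae_le_of_forall_setIntegral_le (hf.const_mul (-1)) (integrable_const L)
    fun S hS _ => key (-1) (by simp) S hS
  obtain ⟨f₀, hf₀, hff₀⟩ := (Lp.aestronglyMeasurable f)
  have hb : ∀ s, |max (-L) (min L (f₀ s))| ≤ L := fun s =>
    abs_le.2 ⟨le_max_left _ _, max_le (by linarith) (min_le_left _ _)⟩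
  refine ⟨fun s => max (-L) (min L (f₀ s)),
    ⟨measurable_const.max (measurable_const.min hf₀.measurable), L, hb⟩, hb, ?_⟩
  filter_upwards [h1, h2, hff₀] with s hs1 hs2 hs3
  rw [← hs3, min_eq_right (by linarith), max_eq_right (by linarith)]

/-- A convex function bounded below by `-L * ∫ |v|` is bounded below by a linear functional
given by a density bounded by `L`. -/
lemma exists_density_of_convex_of_le {P : (ℝ → ℝ) → Prop} {F : (ℝ → ℝ) → ℝ} {L : ℝ}
    (hL : 0 ≤ L) (hPb : ∀ v, P v → BddMeas v) (hP0 : P fun _ => 0) (hF0 : F (fun _ => 0) = 0)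
    (hPF : ∀ v w, P v → P w → ∀ r t : ℝ, 0 ≤ r → 0 ≤ t → r + t = 1 →
      P (fun s => r * v s + t * w s) ∧ F (fun s => r * v s + t * w s) ≤ r * F v + t * F w)
    (hF : ∀ v, P v → -(L * ∫ s, |v s| ∂μ) ≤ F v) :
    ∃ f : ℝ → ℝ, BddMeas f ∧ (∀ s, |f s| ≤ L) ∧ ∀ v, P v → 0 ≤ F v + ∫ s, f s * v s ∂μ := by
  set D : Set (Lp ℝ 2 μ × ℝ) := {q | q.2 < -(L * ∫ s, |q.1 s| ∂μ)} with hD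
  set C : Set (Lp ℝ 2 μ × ℝ) := {q | ∃ v, P v ∧ q.1 =ᵐ[μ] v ∧ F v ≤ q.2} with hC
  have hDo : IsOpen D := isOpen_lt continuous_snd
    ((continuous_const.mul (continuous_integral_abs_Lp_two.comp continuous_fst)).neg)
  have hDc : Convex ℝ D := by
    intro x hx y hy r t hr ht hrt
    have h1 := mul_le_mul_of_nonneg_left (integral_abs_Lp_two_smul_add x.1 y.1 hr ht) hL
    change x.2 < _ at hx
    change y.2 < _ at hy
    change r * x.2 + t * y.2 < -(L * ∫ s, |(r • x.1 + t • y.1 : Lp ℝ 2 μ) s| ∂μ)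
    have h2 : r * x.2 + t * y.2 < r * (-(L * ∫ s, |x.1 s| ∂μ)) + t * (-(L * ∫ s, |y.1 s| ∂μ)) := by
      rcases hr.eq_or_lt with h | h
      · have ht1 : t = 1 := by linarith
        subst h; subst ht1; linarith
      · have h3 := mul_lt_mul_of_pos_left hx h
        have h4 := mul_le_mul_of_nonneg_left hy.le ht
        linarith
    linarith
  have hCc : Convex ℝ C := by
    rintro x ⟨v, hv, hxv, hFv⟩ y ⟨w, hw, hyw, hFw⟩ r t hr ht hrt
    obtain ⟨h1, h2⟩ := hPF v w hv hw r t hr ht hrt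
    refine ⟨_, h1, ?_, h2.trans (add_le_add (mul_le_mul_of_nonneg_left hFv hr)
      (mul_le_mul_of_nonneg_left hFw ht))⟩
    change (r • x.1 + t • y.1 : Lp ℝ 2 μ) =ᵐ[μ] _
    filter_upwards [Lp.coeFn_add (r • x.1) (t • y.1), Lp.coeFn_smul r x.1, Lp.coeFn_smul t y.1,
      hxv, hyw] with s h1 h2 h3 h4 h5
    rw [h1, Pi.add_apply, h2, h3]
    simp [h4, h5]
  have hdisj : Disjoint D C := by
    rw [Set.disjoint_left]
    rintro x hx ⟨v, hv, hxv, hFv⟩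
    have h1 := hF v hv
    change x.2 < _ at hx
    have h2 : ∫ s, |x.1 s| ∂μ = ∫ s, |v s| ∂μ := by
      refine integral_congr_ae ?_
      filter_upwards [hxv] with s hs
      rw [hs]
    rw [h2] at hx
    linarith
  obtain ⟨Λ, c₀, hΛD, hΛC⟩ := geometric_hahn_banach_open hDc hDo hCc hdisj
  set Λ₁ : StrongDual ℝ (Lp ℝ 2 μ) := Λ.comp (ContinuousLinearMap.inl ℝ _ ℝ) with hΛ₁
  set κ : ℝ := Λ (0, 1) with hκ
  have hΛ : ∀ w r, Λ (w, r) = Λ₁ w + r * κ := fun w r => by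
    have : ((w, r) : Lp ℝ 2 μ × ℝ) = (w, 0) + r • (0, 1) := by simp
    rw [this, map_add, map_smul]
    simp [hΛ₁, hκ]
  have h0C : ((0 : Lp ℝ 2 μ), (0 : ℝ)) ∈ C := ⟨_, hP0, Lp.coeFn_zero _ _ _, hF0.le⟩
  have hc0 : c₀ ≤ 0 := by
    have := hΛC _ h0C
    rw [hΛ] at this
    simpa using this
  have h0D : ∀ r < 0, ((0 : Lp ℝ 2 μ), (r : ℝ)) ∈ D := fun r hr => by
    change r < -(L * ∫ s, |(0 : Lp ℝ 2 μ) s| ∂μ)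
    have : ∫ s, |(0 : Lp ℝ 2 μ) s| ∂μ = 0 := by
      rw [integral_eq_zero_of_ae]
      filter_upwards [Lp.coeFn_zero ℝ 2 μ] with s hs
      rw [hs]
      simp
    rw [this]
    simpa using hr
  have hD0 : ∀ r < 0, r * κ < c₀ := fun r hr => by
    have := hΛD _ (h0D r hr)
    rw [hΛ] at this
    simpa using this
  have hκ0 : 0 < κ := by
    have := hD0 (-1) (by norm_num)
    linarith
  have hc0' : c₀ = 0 := by
    refine le_antisymm hc0 ?_
    by_contra! h
    have := hD0 (c₀ / κ) (div_neg_of_neg_of_pos h hκ0)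
    rw [div_mul_cancel₀ _ hκ0.ne'] at this
    exact lt_irrefl _ this
  have hκ1 : κ⁻¹ * κ = 1 := inv_mul_cancel₀ hκ0.ne'
  set f : Lp ℝ 2 μ := (InnerProductSpace.toDual ℝ (Lp ℝ 2 μ)).symm (κ⁻¹ • Λ₁) with hf
  have hfw : ∀ w, ⟪f, w⟫ = κ⁻¹ * Λ₁ w := fun w => by
    rw [hf, InnerProductSpace.toDual_symm_apply]; rfl
  have hfN : ∀ w : Lp ℝ 2 μ, ⟪f, w⟫ ≤ L * ∫ s, |w s| ∂μ := fun w => by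
    refine le_of_forall_lt fun r hr => ?_
    by_contra! h
    have h1 := hΛD (w, -⟪f, w⟫) ?_
    · rw [hΛ, hfw, hc0'] at h1
      have : Λ₁ w + -(κ⁻¹ * Λ₁ w) * κ = Λ₁ w - (κ⁻¹ * κ) * Λ₁ w := by ring
      rw [this, hκ1] at h1
      linarith
    · change -⟪f, w⟫ < -(L * ∫ s, |w s| ∂μ)
      linarith
  obtain ⟨f', hf'1, hf'2, hf'3⟩ := exists_bddMeas_repr hL hfN
  refine ⟨f', hf'1, hf'2, fun v hv => ?_⟩
  have hvL := ((hPb v hv).memLp (μ := μ)).coeFn_toLp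
  have h1 := hΛC (((hPb v hv).memLp (μ := μ)).toLp, F v) ⟨v, hv, hvL, le_rfl⟩
  have h2 : ⟪f, ((hPb v hv).memLp (μ := μ)).toLp⟫ = ∫ s, f' s * v s ∂μ := by
    rw [inner_Lp_two_eq_integral _ _ hvL]
    refine integral_congr_ae ?_
    filter_upwards [hf'3] with s hs
    rw [hs]
  rw [← h2, hfw]
  rw [hΛ, hc0'] at h1
  have h3 := mul_nonneg (inv_pos.2 hκ0).le h1
  have h4 : κ⁻¹ * (Λ₁ ((hPb v hv).memLp (μ := μ)).toLp + F v * κ) =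
      (κ⁻¹ * κ) * F v + κ⁻¹ * Λ₁ ((hPb v hv).memLp (μ := μ)).toLp := by ring
  rw [h4, hκ1, one_mul] at h3
  exact h3

end duality

/-- Linearization of the penalized minimality of `u`. -/
lemma exists_multiplier {φ : E2 → ℝ} {u : ℝ → ℝ} {a b L : ℝ} (hL : 0 ≤ L) (hub : BddMeas u)
    (hA : aniArea φ u (Ioo a b) ≠ ⊤)
    (hmin : ∀ v, BddMeas v → aniArea φ v (Ioo a b) ≠ ⊤ → (aniArea φ u (Ioo a b)).toReal ≤
      (aniArea φ v (Ioo a b)).toReal + L * ∫ s in Ioo a b, |v s - u s|) :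
    ∃ f : ℝ → ℝ, BddMeas f ∧ (∀ s, |f s| ≤ L) ∧ ∀ v, BddMeas v → aniArea φ v (Ioo a b) ≠ ⊤ →
      (aniArea φ u (Ioo a b)).toReal ≤
        (aniArea φ v (Ioo a b)).toReal + ∫ s in Ioo a b, f s * (v s - u s) := by
  have hi : ∀ w, BddMeas w → IntegrableOn w (Ioo a b) := fun w hw => hw.integrableOn (by simp)
  obtain ⟨f, hf1, hf2, hf3⟩ := exists_density_of_convex_of_le (μ := volume.restrict (Ioo a b))
    (P := fun w => BddMeas w ∧ aniArea φ (fun s => u s + w s) (Ioo a b) ≠ ⊤)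
    (F := fun w => (aniArea φ (fun s => u s + w s) (Ioo a b)).toReal -
      (aniArea φ u (Ioo a b)).toReal) hL (fun v hv => hv.1)
    ⟨BddMeas.const 0, by simpa using hA⟩ (by simp)
    (fun v w hv hw r t hr ht hrt => by
      have e : (fun s => u s + (r * v s + t * w s)) =
          fun s => r * (u s + v s) + t * (u s + w s) := by
        ext s
        have : u s = (r + t) * u s := by rw [hrt, one_mul]
        linear_combination this
      have h1 := aniArea_convex (hi _ (hub.add hv.1)) (hi _ (hub.add hw.1)) hv.2 hw.2 hr ht hrt
      have h2 := ENNReal.toReal_le_of_le_ofReal (add_nonneg (mul_nonneg hr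
        ENNReal.toReal_nonneg) (mul_nonneg ht ENNReal.toReal_nonneg)) h1
      refine ⟨⟨(hv.1.const_mul r).add (hw.1.const_mul t), ?_⟩, ?_⟩
      · rw [e]
        exact ne_top_of_le_ne_top (by simp) h1
      · rw [e]
        have : (aniArea φ u (Ioo a b)).toReal = (r + t) * (aniArea φ u (Ioo a b)).toReal := by
          rw [hrt, one_mul]
        linarith)
    (fun v hv => by
      have h1 := hmin _ (hub.add hv.1) hv.2
      simp only [add_sub_cancel_left] at h1
      linarith)
  refine ⟨f, hf1, hf2, fun v hv hAv => ?_⟩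
  have h1 := hf3 (fun s => v s - u s) ⟨hv.sub hub, by simpa using hAv⟩
  simp only [add_sub_cancel] at h1
  linarith

section multiplier

variable {φ : E2 → ℝ} {m : ℝ} {H : ℝ → ℝ} {u k : ℝ → ℝ} {a b : ℝ}

lemma integral_multiplier_eq_zero (hab : a < b) (hH : IsProfile m H)
    (hW : ∀ t s, φ (vec2 t s) ≤ 1 ↔ |t| ≤ m ∧ |s| ≤ H t)
    (hu : IntegrableOn u (Ioo a b)) (hk : BddMeas k)
    (hmul : ∀ v, BddMeas v → aniArea φ v (Ioo a b) ≠ ⊤ → (aniArea φ u (Ioo a b)).toReal ≤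
        (aniArea φ v (Ioo a b)).toReal + ∫ s in Ioo a b, k s * (u s - v s)) :
    ∫ s in Ioo a b, k s = 0 := by
  set α := (aniArea φ u (Ioo a b)).toReal with hα
  have h1 : ∀ c : ℝ, α ≤ H 0 * (b - a) + ((∫ s in Ioo a b, k s * u s) -
      c * ∫ s in Ioo a b, k s) := fun c => by
    have h2 := aniArea_const_le hab hH hW c
    have h3 := hmul (fun _ => c) (BddMeas.const c) (ne_top_of_le_ne_top (by simp) h2)
    have h4 := ENNReal.toReal_le_of_le_ofReal
      (mul_nonneg (hH.nonneg 0) (by linarith : 0 ≤ b - a)) h2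
    have e : ∫ s in Ioo a b, k s * (u s - c) =
        (∫ s in Ioo a b, k s * u s) - c * ∫ s in Ioo a b, k s := by
      rw [← integral_const_mul, ← integral_sub (hk.integrable_mul_left hu)
        ((hk.integrableOn (by simp)).const_mul c)]
      congr 1
      ext s
      ring
    rw [e] at h3
    linarith
  by_contra h
  have h2 := h1 ((1 + H 0 * (b - a) + (∫ s in Ioo a b, k s * u s) - α) / ∫ s in Ioo a b, k s)
  rw [div_mul_cancel₀ _ h] at h2
  linarith

lemma toReal_aniArea_le_of_multiplier (hab : a < b)
    (hu : IntegrableOn u (Ioo a b)) (hk : BddMeas k) (hk0 : prim a k b = 0)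
    (hmul : ∀ v, BddMeas v → aniArea φ v (Ioo a b) ≠ ⊤ → (aniArea φ u (Ioo a b)).toReal ≤
        (aniArea φ v (Ioo a b)).toReal + ∫ s in Ioo a b, k s * (u s - v s))
    {y R : ℝ → ℝ} (hy : BddMeas y) (hR : IntegrableOn R (Ioo a b))
    (h0 : 0 ≤ ∫ s in Ioo a b, R s)
    (h : ∀ s ∈ Ioo a b, ∀ x₁ x₂, φ (vec2 x₁ x₂) ≤ 1 → y s * x₁ + x₂ ≤ R s) :
    (aniArea φ u (Ioo a b)).toReal ≤ (∫ s in Ioo a b, R s) + (∫ s in Ioo a b, u s * k s) -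
      ∫ s in Ioo a b, prim a k s * y s := by
  set v : ℝ → ℝ := (Ioo a b).indicator fun s => 0 - prim a y s with hv
  have hvb : BddMeas v := by
    refine ⟨(measurable_const.sub (continuous_prim hy).measurable).indicator measurableSet_Ioo,
      ∫ r in Ioo a b, |y r|, fun s => ?_⟩
    by_cases hs : s ∈ Ioo a b
    · simp only [hv, indicator_of_mem hs, zero_sub, abs_neg]
      exact abs_prim_le hy (Ioo_subset_Icc_self hs)
    · simp only [hv, indicator_of_notMem hs, abs_zero]
      exact integral_nonneg fun _ => abs_nonneg _
  have hvv : ∀ᵐ s ∂(volume.restrict (Ioo a b)), v s = 0 - prim a y s := by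
    filter_upwards [ae_restrict_mem measurableSet_Ioo] with s hs
    simp only [hv, indicator_of_mem hs]
  have h1 := aniArea_sub_prim_le hab 0 hy hR h
  rw [← aniArea_congr hvv] at h1
  have h2 := hmul v hvb (ne_top_of_le_ne_top (by simp) h1)
  have h3 := ENNReal.toReal_le_of_le_ofReal h0 h1
  have hpi : IntegrableOn (prim a y) (Ioo a b) :=
    ((continuous_prim hy).continuousOn.integrableOn_Icc (a := a) (b := b)).mono_set
      Ioo_subset_Icc_self
  have e : ∫ s in Ioo a b, k s * (u s - v s) =
      (∫ s in Ioo a b, u s * k s) - ∫ s in Ioo a b, prim a k s * y s := by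
    have h4 := integral_prim_mul hab.le hk hy
    rw [hk0, zero_mul, zero_sub] at h4
    rw [h4, sub_neg_eq_add, ← integral_add (hk.integrable_mul hu) (hk.integrable_mul_left hpi)]
    refine integral_congr_ae ?_
    filter_upwards [hvv] with s hs
    rw [hs]
    ring
  rw [e] at h2
  linarith

lemma mul_prim_multiplier_le (hab : a < b) (hH : IsProfile m H)
    (hW : ∀ t s, φ (vec2 t s) ≤ 1 ↔ |t| ≤ m ∧ |s| ≤ H t)
    (hu : IntegrableOn u (Ioo a b)) (hk : BddMeas k) (hk0 : prim a k b = 0)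
    (hzb : BddMeas (prim a k))
    (hmul : ∀ v, BddMeas v → aniArea φ v (Ioo a b) ≠ ⊤ → (aniArea φ u (Ioo a b)).toReal ≤
        (aniArea φ v (Ioo a b)).toReal + ∫ s in Ioo a b, k s * (u s - v s))
    {θ : ℝ} (hθ : |θ| = 1) {s : ℝ} (hs : s ∈ Ioo a b) : θ * prim a k s ≤ m := by
  have hm := hH.m_pos
  set α := (aniArea φ u (Ioo a b)).toReal with hα
  set w : ℝ → ℝ := fun s => max (θ * prim a k s - m) 0 with hw
  have hw0 : ∀ s, 0 ≤ w s := fun s => le_max_right _ _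
  have hwc : Continuous w :=
    ((continuous_const.mul (continuous_prim hk)).sub continuous_const).max continuous_const
  have hwb : BddMeas w := by
    obtain ⟨B, hB⟩ := hzb.2
    refine ⟨hwc.measurable, B, fun s => ?_⟩
    rw [abs_of_nonneg (hw0 s)]
    refine max_le ?_ ((abs_nonneg _).trans (hB s))
    have h1 := le_abs_self (θ * prim a k s)
    rw [abs_mul, hθ, one_mul] at h1
    linarith [hB s]
  have hwi : IntegrableOn w (Ioo a b) := hwb.integrableOn (by simp)
  have hzwi : IntegrableOn (fun s => θ * prim a k s * w s) (Ioo a b) :=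
    ((hzb.const_mul θ).mul hwb).integrableOn (by simp)
  have hN : ∀ N : ℝ, 0 ≤ N → α ≤ H 0 * (b - a) + (∫ s in Ioo a b, u s * k s) -
      N * ∫ s in Ioo a b, (θ * prim a k s - m) * w s := by
    intro N hN
    have hRi : IntegrableOn (fun s => m * (N * w s) + H 0) (Ioo a b) :=
      ((hwi.const_mul N).const_mul m).add (integrable_const _)
    have h1 := toReal_aniArea_le_of_multiplier hab hu hk hk0 hmul (y := fun s => θ * (N * w s))
      (R := fun s => m * (N * w s) + H 0) ((hwb.const_mul N).const_mul θ) hRi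
      (integral_nonneg fun s => add_nonneg (mul_nonneg hm.le (mul_nonneg hN (hw0 s)))
        (hH.nonneg 0)) (fun s _ x₁ x₂ hx => by
        rw [hW] at hx
        have h2 : θ * x₁ ≤ m := by
          refine (le_abs_self _).trans ?_
          rw [abs_mul, hθ, one_mul]
          exact hx.1
        have h3 := mul_le_mul_of_nonneg_right h2 (mul_nonneg hN (hw0 s))
        linarith [le_abs_self x₂, hx.2, hH.le_zero hx.1])
    have e1 : ∫ s in Ioo a b, (m * (N * w s) + H 0) =
        m * N * (∫ s in Ioo a b, w s) + H 0 * (b - a) := by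
      rw [integral_add ((hwi.const_mul N).const_mul m) (integrable_const _), integral_const_mul,
        integral_const_mul]
      simp [Real.volume_real_Ioo_of_le hab.le]
      ring
    have e2 : ∫ s in Ioo a b, prim a k s * (θ * (N * w s)) =
        N * ∫ s in Ioo a b, θ * prim a k s * w s := by
      rw [← integral_const_mul]
      congr 1
      ext s
      ring
    have e3 : ∫ s in Ioo a b, (θ * prim a k s - m) * w s =
        (∫ s in Ioo a b, θ * prim a k s * w s) - m * ∫ s in Ioo a b, w s := by
      rw [← integral_const_mul, ← integral_sub hzwi (hwi.const_mul m)]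
      congr 1
      ext s
      ring
    rw [e1, e2] at h1
    rw [e3]
    linarith
  have hww : ∀ s, (θ * prim a k s - m) * w s = w s * w s := fun s => by
    simp only [hw]
    rcases le_total (θ * prim a k s - m) 0 with h | h
    · rw [max_eq_right h]; ring
    · rw [max_eq_left h]
  simp only [hww] at hN
  have hzero : ∫ s in Ioo a b, w s * w s = 0 := by
    have h0 : 0 ≤ ∫ s in Ioo a b, w s * w s := integral_nonneg fun s => mul_self_nonneg _
    refine le_antisymm ?_ h0
    by_contra! h
    set X := H 0 * (b - a) + (∫ s in Ioo a b, u s * k s) with hX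
    have h1 := hN ((|X - α| + 1) / ∫ s in Ioo a b, w s * w s) (by positivity)
    rw [div_mul_cancel₀ _ h.ne'] at h1
    linarith [le_abs_self (X - α)]
  rw [integral_eq_zero_iff_of_nonneg (fun s => mul_self_nonneg _)
    ((hwb.mul hwb).integrableOn (by simp))] at hzero
  have h1 := Measure.eqOn_Ioo_of_ae_eq volume hzero (hwc.mul hwc).continuousOn
    continuousOn_const hs
  have h2 : w s = 0 := mul_self_eq_zero.1 h1
  have h3 := le_max_left (θ * prim a k s - m) 0
  simp only [hw] at h2
  linarith

/-- `k` maximizes the dual functional `l ↦ ∫ u * l + ∫ H (prim a l)`. -/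
structure IsDualMax (m : ℝ) (H : ℝ → ℝ) (a b : ℝ) (u k : ℝ → ℝ) : Prop where
  bdd : BddMeas k
  prim_right : prim a k b = 0
  abs_le : ∀ s ∈ Icc a b, |prim a k s| ≤ m
  max : ∀ l, BddMeas l → prim a l b = 0 → (∀ s ∈ Icc a b, |prim a l s| ≤ m) →
    (∫ s in Ioo a b, u s * l s) + ∫ s in Ioo a b, H (prim a l s) ≤
      (∫ s in Ioo a b, u s * k s) + ∫ s in Ioo a b, H (prim a k s)

lemma IsDualMax.neg (hH : IsProfile m H) (h : IsDualMax m H a b u k) :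
    IsDualMax m H a b (fun s => -u s) (fun s => -k s) where
  bdd := h.bdd.neg
  prim_right := by rw [prim_neg, h.prim_right, neg_zero]
  abs_le := fun s hs => by rw [prim_neg, abs_neg]; exact h.abs_le s hs
  max := fun l hl hl0 hlm => by
    have := h.max (fun s => -l s) hl.neg (by rw [prim_neg, hl0, neg_zero])
      (fun s hs => by rw [prim_neg, abs_neg]; exact hlm s hs)
    simp only [prim_neg, hH.even] at this ⊢
    simpa using this

lemma prim_of_eq_zero_off (hk0 : prim a k b = 0) (hk : BddMeas k)
    (h : ∀ s, s ∉ Ioo a b → k s = 0) {s : ℝ} (hs : s ∉ Ioo a b) : prim a k s = 0 := by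
  rcases le_or_gt s a with h1 | h1
  · refine intervalIntegral.integral_zero_ae (Eventually.of_forall fun x hx => h x ?_)
    have h2 : x ≤ max a s := hx.2
    rw [max_eq_left h1] at h2
    exact fun h' => absurd h'.1 (not_lt.2 h2)
  · have h2 : b ≤ s := by
      by_contra! h3
      exact hs ⟨h1, h3⟩
    have h3 : prim a k s - prim a k b = 0 := by
      rw [prim_sub_prim hk]
      refine intervalIntegral.integral_zero_ae (Eventually.of_forall fun x hx => h x ?_)
      have h4 : min b s < x := hx.1
      rw [min_eq_left h2] at h4
      exact fun h' => absurd h'.2 (not_lt.2 h4.le)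
    linarith

lemma exists_isDualMax (hab : a < b) (hH : IsProfile m H)
    (hW : ∀ t s, φ (vec2 t s) ≤ 1 ↔ |t| ≤ m ∧ |s| ≤ H t) {L : ℝ} (hL : 0 ≤ L)
    (hub : BddMeas u) (hA : aniArea φ u (Ioo a b) ≠ ⊤)
    (hmin : ∀ v, BddMeas v → aniArea φ v (Ioo a b) ≠ ⊤ → (aniArea φ u (Ioo a b)).toReal ≤
      (aniArea φ v (Ioo a b)).toReal + L * ∫ s in Ioo a b, |v s - u s|) :
    ∃ k, IsDualMax m H a b u k ∧ ∀ s, |k s| ≤ L := by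
  have hm := hH.m_pos
  have hu : IntegrableOn u (Ioo a b) := hub.integrableOn (by simp)
  obtain ⟨f, hf1, hf2, hf3⟩ := exists_multiplier hL hub hA hmin
  set k : ℝ → ℝ := (Ioo a b).indicator fun s => -f s with hk
  have hkL : ∀ s, |k s| ≤ L := fun s => by
    by_cases hs : s ∈ Ioo a b
    · simp only [hk, indicator_of_mem hs, abs_neg]; exact hf2 s
    · simp only [hk, indicator_of_notMem hs, abs_zero]; exact hL
  have hkb : BddMeas k := ⟨hf1.neg.1.indicator measurableSet_Ioo, L, hkL⟩
  have hmul : ∀ v, BddMeas v → aniArea φ v (Ioo a b) ≠ ⊤ → (aniArea φ u (Ioo a b)).toReal ≤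
        (aniArea φ v (Ioo a b)).toReal + ∫ s in Ioo a b, k s * (u s - v s) := fun v hv hAv => by
    refine (hf3 v hv hAv).trans_eq ?_
    congr 1
    refine setIntegral_congr_fun measurableSet_Ioo fun s hs => ?_
    simp only [hk, indicator_of_mem hs]
    ring
  have hk0 : prim a k b = 0 := by
    rw [prim_right hab.le, integral_multiplier_eq_zero hab hH hW hu hkb hmul]
  have hzoff : ∀ s, s ∉ Ioo a b → prim a k s = 0 := fun s hs =>
    prim_of_eq_zero_off hk0 hkb (fun s hs => by simp only [hk, indicator_of_notMem hs]) hs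
  have hzb : BddMeas (prim a k) := by
    refine ⟨(continuous_prim hkb).measurable, ∫ r in Ioo a b, |k r|, fun s => ?_⟩
    by_cases hs : s ∈ Ioo a b
    · exact abs_prim_le hkb (Ioo_subset_Icc_self hs)
    · rw [hzoff s hs, abs_zero]
      exact integral_nonneg fun _ => abs_nonneg _
  have hzm : ∀ s, |prim a k s| ≤ m := fun s => by
    by_cases hs : s ∈ Ioo a b
    · have h1 := mul_prim_multiplier_le hab hH hW hu hkb hk0 hzb hmul (θ := 1) (by simp) hs
      have h2 := mul_prim_multiplier_le hab hH hW hu hkb hk0 hzb hmul (θ := -1) (by simp) hs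
      exact abs_le.2 ⟨by linarith, by linarith⟩
    · rw [hzoff s hs, abs_zero]; exact hm.le
  have hzc := continuous_prim (a := a) hkb
  have hδ : ∀ δ ∈ Ioo (0 : ℝ) 1, (aniArea φ u (Ioo a b)).toReal ≤
      (∫ s in Ioo a b, H ((1 - δ) * prim a k s)) + ∫ s in Ioo a b, u s * k s := by
    intro δ hδ
    have hδ1 : 0 ≤ 1 - δ := by linarith [hδ.2]
    have hxm : ∀ s, |(1 - δ) * prim a k s| ≤ (1 - δ) * m := fun s => by
      rw [abs_mul, abs_of_nonneg hδ1]
      exact mul_le_mul_of_nonneg_left (hzm s) hδ1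
    have hlt : (1 - δ) * m < m := by nlinarith [hδ.1]
    obtain ⟨ρ, C, hρ1, -, hρ2, hρ3⟩ := hH.exists_supergradient (mul_nonneg hδ1 hm.le) hlt
    set y : ℝ → ℝ := fun s => ρ ((1 - δ) * prim a k s) with hy
    have hyb : BddMeas y := ⟨hρ1.comp (hzc.measurable.const_mul _), C, fun s => hρ2 _⟩
    have hHb : BddMeas fun s => H ((1 - δ) * prim a k s) :=
      hH.bddMeas_comp (hzc.measurable.const_mul _) fun s => (hxm s).trans hlt.le
    have hyz : ∀ s, 0 ≤ y s * ((1 - δ) * prim a k s) := fun s => by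
      have h1 := hρ3 _ (hxm s) 0 (by rw [abs_zero]; exact hm.le)
      have h2 := hH.le_zero ((hxm s).trans hlt.le)
      simp only [hy]
      linarith
    have hyzb := hyb.mul (hzb.const_mul (1 - δ))
    have h1 := toReal_aniArea_le_of_multiplier hab hu hkb hk0 hmul hyb
      (R := fun s => y s * ((1 - δ) * prim a k s) + H ((1 - δ) * prim a k s))
      ((hyzb.add hHb).integrableOn (by simp))
      (integral_nonneg fun s => add_nonneg (hyz s) (hH.nonneg _)) (fun s _ x₁ x₂ hx => by
        rw [hW] at hx
        have h1 := hρ3 _ (hxm s) x₁ hx.1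
        simp only [hy]
        linarith [le_abs_self x₂, hx.2])
    rw [integral_add (hyzb.integrableOn (by simp)) (hHb.integrableOn (by simp))] at h1
    have h2 : ∫ s in Ioo a b, y s * ((1 - δ) * prim a k s) ≤
        ∫ s in Ioo a b, prim a k s * y s := by
      refine integral_mono (hyzb.integrableOn (by simp)) ((hzb.mul hyb).integrableOn (by simp))
        fun s => ?_
      have h3 : 0 ≤ prim a k s * y s := by
        have h4 := hyz s
        have h5 : y s * ((1 - δ) * prim a k s) = (1 - δ) * (prim a k s * y s) := by ring
        rw [h5] at h4
        exact nonneg_of_mul_nonneg_right h4 (by linarith [hδ.2])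
      have h4 := mul_nonneg hδ.1.le h3
      simp only
      linarith
    linarith
  have hlim := (hH.tendsto_integral_comp_mul (a := a) (b := b) hzc fun s _ => hzm s).add_const
    (∫ s in Ioo a b, u s * k s)
  have hα := ge_of_tendsto hlim (by
    filter_upwards [Ioo_mem_nhdsGT (zero_lt_one' ℝ)] with δ h using hδ δ h)
  refine ⟨k, ⟨hkb, hk0, fun s _ => hzm s, fun l hl hl0 hlm => ?_⟩, hkL⟩
  have h1 := integral_add_profile_le hab hH hW hu hA hl hl0 hlm
  linarith

end multiplier

namespace IsDualMax

variable {m : ℝ} {H : ℝ → ℝ} {u k l : ℝ → ℝ} {a b L : ℝ}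

lemma integral_sub_le (hH : IsProfile m H) (hu : IntegrableOn u (Ioo a b))
    (h : IsDualMax m H a b u k) (hl : BddMeas l) (hl0 : prim a l b = 0)
    (hm : ∀ s ∈ Icc a b, |prim a k s - prim a l s| ≤ m) :
    ∫ s in Ioo a b, (H (prim a k s - prim a l s) - H (prim a k s)) ≤
      ∫ s in Ioo a b, u s * l s := by
  have h1 := h.max _ (h.bdd.sub hl) (by rw [prim_sub h.bdd hl, h.prim_right, hl0, sub_zero])
    (fun s hs => by rw [prim_sub h.bdd hl]; exact hm s hs)
  simp only [prim_sub h.bdd hl, mul_sub] at h1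
  have hc := continuous_prim (a := a) h.bdd
  rw [integral_sub (h.bdd.integrable_mul hu) (hl.integrable_mul hu)] at h1
  rw [integral_sub (hH.integrableOn_comp (h := fun s => prim a k s - prim a l s)
    (hc.sub (continuous_prim hl)) a b)
    (hH.integrableOn_comp hc a b)]
  linarith

lemma sub_lt_of_lt_prim (h : IsDualMax m H a b u k) (hL : ∀ s, |k s| ≤ L) {t s : ℝ}
    (hs : s ∈ Icc a b) (ht : t < prim a k s) : t < L * (s - a) ∧ t < L * (b - s) := by
  have h1 := le_of_abs_le (abs_prim_sub_le (a := a) h.bdd hL a s)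
  have h2 := le_of_abs_le (abs_prim_sub_le (a := a) h.bdd hL b s)
  rw [prim_left, abs_of_nonneg (by linarith [hs.1])] at h1
  rw [h.prim_right, abs_of_nonpos (by linarith [hs.2])] at h2
  constructor <;> linarith

lemma prim_le (hH : IsProfile m H) (hu : IntegrableOn u (Ioo a b))
    (h : IsDualMax m H a b u k) (hL0 : 0 < L) (hL : ∀ s, |k s| ≤ L) {t₀ q : ℝ}
    (ht₀ : 0 < t₀) (htm : t₀ < m) (hq : 0 < q)
    (hslope : ∀ x y, t₀ ≤ x → x ≤ y → y ≤ m → q * (y - x) ≤ H x - H y)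
    (hsmall : 2 * ∫ s in Ioo a b, |u s| < q * ((m - t₀) / (4 * L)) ^ 2) {s : ℝ}
    (hs : s ∈ Icc a b) : prim a k s ≤ (t₀ + m) / 2 := by
  by_contra! hlt
  set r := (m - t₀) / (4 * L) with hr
  set ε := (m - t₀) / 4 with hε
  have hr0 : 0 < r := div_pos (by linarith) (by linarith)
  have hε0 : 0 < ε := by rw [hε]; linarith
  have hLr : L * r = ε := by rw [hr, hε]; field_simp
  obtain ⟨h1, h2⟩ := h.sub_lt_of_lt_prim hL hs hlt
  have ha : a < s - r := by
    have : L * r < L * (s - a) := by linarith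
    linarith [lt_of_mul_lt_mul_left this hL0.le]
  have hb : s + r < b := by
    have : L * r < L * (b - s) := by linarith
    linarith [lt_of_mul_lt_mul_left this hL0.le]
  have hnear : ∀ x, s - r ≤ x → x ≤ s + r → t₀ + ε ≤ prim a k x := fun x hx1 hx2 => by
    have h3 := _root_.abs_le.1 (abs_prim_sub_le (a := a) h.bdd hL s x)
    have h4 : L * |x - s| ≤ L * r :=
      mul_le_mul_of_nonneg_left (_root_.abs_le.2 ⟨by linarith, by linarith⟩) hL0.le
    linarith [h3.1]
  set T := trapSlope (r / 2) (s - r) (s + r / 2) with hT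
  have hδ : 0 < r / 2 := by linarith
  have hx : a ≤ s - r := ha.le
  have hxy : s - r + r / 2 ≤ s + r / 2 := by linarith
  have hmem : ∀ x ∈ Icc a b, prim a T x ∈ Icc (0 : ℝ) 1 := fun x hx' =>
    prim_trapSlope_mem hδ hx hxy hx'.1
  have hoff : ∀ x ∈ Icc a b, x < s - r ∨ s + r < x → prim a T x = 0 := fun x hx' ho =>
    prim_trapSlope_eq_zero hδ hx hxy hx'.1
      (by rcases ho with ho | ho; exacts [Or.inl ho.le, Or.inr (by linarith)])
  have hTb : BddMeas T := bddMeas_trapSlope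
  have hgain : ∀ x ∈ Icc a b, |prim a k x - ε * prim a T x| ≤ m ∧
      q * (ε * prim a T x) ≤ H (prim a k x - ε * prim a T x) - H (prim a k x) := by
    intro x hx'
    by_cases ho : x < s - r ∨ s + r < x
    · rw [hoff x hx' ho, mul_zero, sub_zero]
      exact ⟨h.abs_le x hx', by simp⟩
    · push Not at ho
      have h3 := hnear x ho.1 ho.2
      have h4 := _root_.abs_le.1 (h.abs_le x hx')
      have h5 := hmem x hx'
      have h6 : ε * prim a T x ≤ ε * 1 := mul_le_mul_of_nonneg_left h5.2 hε0.le
      have h7 : 0 ≤ ε * prim a T x := mul_nonneg hε0.le h5.1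
      refine ⟨_root_.abs_le.2 ⟨by linarith, by linarith [h4.2]⟩, ?_⟩
      have := hslope (prim a k x - ε * prim a T x) (prim a k x) (by linarith) (by linarith) h4.2
      linarith
  have hmain := h.integral_sub_le hH hu (l := fun x => ε * T x) (hTb.const_mul ε)
    (by rw [prim_const_mul, hoff b ⟨by linarith, le_rfl⟩ (Or.inr hb), mul_zero])
    (fun x hx' => by rw [prim_const_mul]; exact (hgain x hx').1)
  simp only [prim_const_mul] at hmain
  have hTc := continuous_prim (a := a) hTb
  have hkc := continuous_prim (a := a) h.bdd
  have hTi : IntegrableOn (prim a T) (Ioo a b) :=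
    (hTc.continuousOn.integrableOn_Icc (a := a) (b := b)).mono_set Ioo_subset_Icc_self
  have hlow : q * ε * r ≤
      ∫ x in Ioo a b, (H (prim a k x - ε * prim a T x) - H (prim a k x)) := by
    have h3 : ∫ x in Ioo a b, q * (ε * prim a T x) ≤
        ∫ x in Ioo a b, (H (prim a k x - ε * prim a T x) - H (prim a k x)) :=
      setIntegral_mono_on ((hTi.const_mul ε).const_mul q)
        ((hH.integrableOn_comp (hkc.sub (hTc.const_mul ε)) a b).sub
          (hH.integrableOn_comp hkc a b)) measurableSet_Ioo
        fun x hx' => (hgain x (Ioo_subset_Icc_self hx')).2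
    have h4 : r ≤ ∫ x in Ioo a b, prim a T x := by
      have h5 : ∫ x in Ioo (s - r / 2) (s + r / 2), (1 : ℝ) =
          ∫ x in Ioo (s - r / 2) (s + r / 2), prim a T x :=
        setIntegral_congr_fun measurableSet_Ioo fun x hx' =>
          (prim_trapSlope_eq_one hδ hx hxy ⟨by linarith [hx'.1], hx'.2.le⟩).symm
      have h6 : ∫ x in Ioo (s - r / 2) (s + r / 2), (1 : ℝ) = r := by
        simp [Real.volume_real_Ioo_of_le (by linarith : s - r / 2 ≤ s + r / 2)]
      rw [← h6, h5]
      refine setIntegral_mono_set hTi ?_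
        (Ioo_subset_Ioo (by linarith) (by linarith)).eventuallyLE
      filter_upwards [ae_restrict_mem measurableSet_Ioo] with x hx'
      exact (hmem x (Ioo_subset_Icc_self hx')).1
    rw [integral_const_mul, integral_const_mul, ← mul_assoc] at h3
    exact (mul_le_mul_of_nonneg_left h4 (by positivity)).trans h3
  have hupp : ∫ x in Ioo a b, u x * (ε * T x) ≤ ε * (2 / r) * ∫ x in Ioo a b, |u x| := by
    rw [← integral_const_mul]
    refine integral_mono ((hTb.const_mul ε).integrable_mul hu) (hu.abs.const_mul _) fun x => ?_
    have h3 := abs_trapSlope_le (x := s - r) (y := s + r / 2) hδ x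
    calc u x * (ε * T x) ≤ |u x * (ε * T x)| := le_abs_self _
      _ = ε * |u x| * |T x| := by rw [abs_mul, abs_mul, abs_of_pos hε0]; ring
      _ ≤ ε * |u x| * (r / 2)⁻¹ := mul_le_mul_of_nonneg_left h3 (by positivity)
      _ = _ := by rw [inv_div]; ring
  have h3 : ε * (q * r) ≤ ε * (2 / r * ∫ x in Ioo a b, |u x|) := by linarith
  have h4 := le_of_mul_le_mul_left h3 hε0
  have h5 : q * r * r ≤ 2 * ∫ x in Ioo a b, |u x| := by
    rw [div_mul_eq_mul_div, le_div_iff₀ hr0] at h4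
    exact h4
  rw [pow_two] at hsmall
  linarith

lemma abs_prim_le_of_small (hH : IsProfile m H) (hu : IntegrableOn u (Ioo a b))
    (h : IsDualMax m H a b u k) (hL0 : 0 < L) (hL : ∀ s, |k s| ≤ L) {t₀ q : ℝ}
    (ht₀ : 0 < t₀) (htm : t₀ < m) (hq : 0 < q)
    (hslope : ∀ x y, t₀ ≤ x → x ≤ y → y ≤ m → q * (y - x) ≤ H x - H y)
    (hsmall : 2 * ∫ s in Ioo a b, |u s| < q * ((m - t₀) / (4 * L)) ^ 2) {s : ℝ}
    (hs : s ∈ Icc a b) : |prim a k s| ≤ (t₀ + m) / 2 := by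
  have h1 := h.prim_le hH hu hL0 hL ht₀ htm hq hslope hsmall hs
  have h2 := (h.neg hH).prim_le hH hu.neg hL0 (by simpa using hL) ht₀ htm hq hslope
    (by simpa using hsmall) hs
  rw [prim_neg] at h2
  exact _root_.abs_le.2 ⟨by linarith, h1⟩

lemma abs_integral_mul_le (hH : IsProfile m H) (hu : IntegrableOn u (Ioo a b))
    (h : IsDualMax m H a b u k) {t C : ℝ} (htm : t < m)
    (hz : ∀ s ∈ Icc a b, |prim a k s| ≤ t)
    (hC : ∀ x y, |x| ≤ (t + m) / 2 → |y| ≤ (t + m) / 2 → |H x - H y| ≤ C * |x - y|)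
    (hl : BddMeas l) (hl0 : prim a l b = 0) :
    ∫ s in Ioo a b, u s * l s ≤ C * ∫ s in Ioo a b, |prim a l s| := by
  obtain ⟨B, hB⟩ : ∃ B, ∀ s ∈ Icc a b, |prim a l s| ≤ B := ⟨_, fun s hs => abs_prim_le hl hs⟩
  set ε := ((m - t) / 2) / (|B| + 1) with hε
  have hB1 : 0 < |B| + 1 := by positivity
  have hε0 : 0 < ε := div_pos (by linarith) hB1
  have hεl : ∀ s ∈ Icc a b, |ε * prim a l s| ≤ (m - t) / 2 := fun s hs => by
    rw [abs_mul, abs_of_pos hε0, hε, div_mul_eq_mul_div, div_le_iff₀ hB1]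
    exact mul_le_mul_of_nonneg_left (by linarith [hB s hs, le_abs_self B]) (by linarith)
  have hzl : ∀ s ∈ Icc a b, |prim a k s + ε * prim a l s| ≤ (t + m) / 2 := fun s hs => by
    linarith [abs_add_le (prim a k s) (ε * prim a l s), hz s hs, hεl s hs]
  have hmain := h.integral_sub_le hH hu (l := fun x => (-ε) * l x) (hl.const_mul _)
    (by rw [prim_const_mul, hl0, mul_zero])
    (fun s hs => by
      rw [prim_const_mul, neg_mul, sub_neg_eq_add]
      linarith [hzl s hs])
  simp only [prim_const_mul] at hmain
  simp only [neg_mul, sub_neg_eq_add, mul_neg] at hmain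
  rw [integral_neg] at hmain
  have hlc := continuous_prim (a := a) hl
  have hkc := continuous_prim (a := a) h.bdd
  have hli : IntegrableOn (fun s => |prim a l s|) (Ioo a b) :=
    (hlc.abs.continuousOn.integrableOn_Icc (a := a) (b := b)).mono_set Ioo_subset_Icc_self
  have h1 : ∫ s in Ioo a b, -(C * (ε * |prim a l s|)) ≤
      ∫ s in Ioo a b, (H (prim a k s + ε * prim a l s) - H (prim a k s)) := by
    refine setIntegral_mono_on ((hli.const_mul ε).const_mul C).neg
      ((hH.integrableOn_comp (hkc.add (hlc.const_mul ε)) a b).sub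
        (hH.integrableOn_comp hkc a b)) measurableSet_Ioo fun x hx => ?_
    have hx' := Ioo_subset_Icc_self hx
    have h2 := (_root_.abs_le.1 (hC _ _ (hzl x hx') ((hz x hx').trans (by linarith)))).1
    rw [add_sub_cancel_left, abs_mul, abs_of_pos hε0] at h2
    exact h2
  rw [integral_neg, integral_const_mul, integral_const_mul] at h1
  have e : ∫ s in Ioo a b, u s * (ε * l s) = ε * ∫ s in Ioo a b, u s * l s := by
    rw [← integral_const_mul]
    congr 1
    ext s
    ring
  rw [e] at hmain
  have h3 : ε * (∫ s in Ioo a b, u s * l s) ≤ ε * (C * ∫ s in Ioo a b, |prim a l s|) := by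
    linarith
  exact le_of_mul_le_mul_left h3 hε0

end IsDualMax

section lipschitz

variable {u : ℝ → ℝ} {a b C : ℝ}

lemma integral_mul_indicator_Ioc (hub : BddMeas u) {x y : ℝ} (hx : a < x) (hxy : x ≤ y)
    (hy : y < b) :
    ∫ s in Ioo a b, u s * (Ioc x y).indicator (fun _ => (1 : ℝ)) s =
      prim a u y - prim a u x := by
  have e : (fun s => u s * (Ioc x y).indicator (fun _ => (1 : ℝ)) s) = (Ioc x y).indicator u := by
    ext s
    by_cases hs : s ∈ Ioc x y <;> simp [hs]
  rw [e, setIntegral_indicator measurableSet_Ioc,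
    inter_eq_self_of_subset_right (s := Ioo a b)
      fun s hs => ⟨hx.trans hs.1, hs.2.trans_lt hy⟩,
    prim_sub_prim hub, intervalIntegral.integral_of_le hxy]

lemma integral_mul_trapSlope (hub : BddMeas u) {δ x y : ℝ} (hδ : 0 < δ) (hx : a < x)
    (hxb : x + δ < b) (hy : a < y) (hyb : y + δ < b) :
    ∫ s in Ioo a b, u s * trapSlope δ x y s =
      δ⁻¹ * (prim a u (x + δ) - prim a u x) - δ⁻¹ * (prim a u (y + δ) - prim a u y) := by
  have hu : IntegrableOn u (Ioo a b) := hub.integrableOn (by simp)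
  rw [← integral_mul_indicator_Ioc hub hx (by linarith) hxb,
    ← integral_mul_indicator_Ioc hub hy (by linarith) hyb, ← mul_sub, ← integral_sub
      ((bddMeas_indicator_one measurableSet_Ioc).integrable_mul hu)
      ((bddMeas_indicator_one measurableSet_Ioc).integrable_mul hu), ← integral_const_mul]
  congr 1
  ext s
  rw [trapSlope]
  ring

lemma integral_abs_prim_trapSlope_le {δ x y : ℝ} (hδ : 0 < δ) (hx : a < x)
    (hxy : x + δ ≤ y) (hyb : y + δ < b) :
    ∫ s in Ioo a b, |prim a (trapSlope δ x y) s| ≤ y + δ - x := by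
  have h1 : ∀ s ∈ Ioo a b, |prim a (trapSlope δ x y) s| ≤
      (Icc x (y + δ)).indicator (fun _ => (1 : ℝ)) s := fun s hs => by
    by_cases h : s ∈ Icc x (y + δ)
    · have h2 := prim_trapSlope_mem hδ hx.le hxy hs.1.le
      rw [indicator_of_mem h, abs_of_nonneg h2.1]
      exact h2.2
    · rw [indicator_of_notMem h, prim_trapSlope_eq_zero hδ hx.le hxy hs.1.le, abs_zero]
      by_contra! h2
      exact h ⟨h2.1.le, h2.2.le⟩
  calc ∫ s in Ioo a b, |prim a (trapSlope δ x y) s|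
      ≤ ∫ s in Ioo a b, (Icc x (y + δ)).indicator (fun _ => (1 : ℝ)) s := by
        refine setIntegral_mono_on ?_ ((bddMeas_indicator_one measurableSet_Icc).integrableOn
          (by simp)) measurableSet_Ioo h1
        exact ((continuous_prim bddMeas_trapSlope).abs.continuousOn.integrableOn_Icc
          (a := a) (b := b)).mono_set Ioo_subset_Icc_self
    _ = y + δ - x := by
        rw [setIntegral_indicator measurableSet_Icc,
          inter_eq_self_of_subset_right (s := Ioo a b)
            fun s hs => ⟨hx.trans_le hs.1, hs.2.trans_lt hyb⟩]
        simp [Real.volume_real_Icc_of_le (by linarith : x ≤ y + δ)]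

lemma abs_sub_le_of_integral_mul_le (hub : BddMeas u)
    (h : ∀ l, BddMeas l → prim a l b = 0 →
      ∫ s in Ioo a b, u s * l s ≤ C * ∫ s in Ioo a b, |prim a l s|) (hC : 0 ≤ C) {x y : ℝ}
    (hx : a < x) (hxy : x < y) (hy : y < b) (hux : HasDerivAt (prim a u) (u x) x)
    (huy : HasDerivAt (prim a u) (u y) y) : |u x - u y| ≤ C * (y - x) := by
  have hlim := ((hux.tendsto_slope_zero.mono_left (nhdsGT_le_nhdsNE 0)).sub
    (huy.tendsto_slope_zero.mono_left (nhdsGT_le_nhdsNE 0))).abs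
  have hlim2 : Tendsto (fun δ : ℝ => C * (y + δ - x)) (𝓝[>] 0) (𝓝 (C * (y - x))) := by
    have : Continuous fun δ : ℝ => C * (y + δ - x) := by fun_prop
    have h2 := this.tendsto 0
    rw [add_zero] at h2
    exact h2.mono_left nhdsWithin_le_nhds
  refine le_of_tendsto_of_tendsto hlim hlim2 ?_
  have hpos : 0 < min (y - x) (b - y) := lt_min (by linarith) (by linarith)
  filter_upwards [Ioo_mem_nhdsGT hpos] with δ hδ
  have hδ1 : x + δ ≤ y := by linarith [hδ.2, min_le_left (y - x) (b - y)]
  have hδ2 : y + δ < b := by linarith [hδ.2, min_le_right (y - x) (b - y)]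
  have h0 : prim a (trapSlope δ x y) b = 0 :=
    prim_trapSlope_eq_zero hδ.1 hx.le hδ1 (by linarith) (Or.inr hδ2.le)
  have hT := bddMeas_trapSlope (δ := δ) (x := x) (y := y)
  have e := integral_mul_trapSlope hub hδ.1 hx (by linarith) (by linarith) hδ2
  have h1 := h _ hT h0
  have h2 := h _ hT.neg (by rw [prim_neg, h0, neg_zero])
  simp only [mul_neg, prim_neg, abs_neg, integral_neg] at h2
  rw [e] at h1 h2
  have h3 := mul_le_mul_of_nonneg_left (integral_abs_prim_trapSlope_le hδ.1 hx hδ1 hδ2) hC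
  simp only [smul_eq_mul]
  exact abs_le.2 ⟨by linarith, by linarith⟩

lemma hasLipschitzRep_of_integral_mul_le (hub : BddMeas u)
    (h : ∀ l, BddMeas l → prim a l b = 0 →
      ∫ s in Ioo a b, u s * l s ≤ C * ∫ s in Ioo a b, |prim a l s|) (hC : 0 ≤ C) :
    HasLipschitzRep u (Ioo a b) := by
  set S := {x ∈ Ioo a b | HasDerivAt (prim a u) (u x) x} with hS
  have hlip : LipschitzOnWith C.toNNReal u S := by
    refine LipschitzOnWith.of_dist_le_mul fun x hx y hy => ?_
    rw [Real.dist_eq, Real.dist_eq, Real.coe_toNNReal C hC]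
    rcases lt_trichotomy x y with hxy | rfl | hxy
    · rw [abs_sub_comm x y, abs_of_pos (sub_pos.2 hxy)]
      exact abs_sub_le_of_integral_mul_le hub h hC hx.1.1 hxy hy.1.2 hx.2 hy.2
    · simp
    · rw [abs_sub_comm, abs_of_pos (sub_pos.2 hxy)]
      exact abs_sub_le_of_integral_mul_le hub h hC hy.1.1 hxy hx.1.2 hy.2 hx.2
  obtain ⟨v, hv, huv⟩ := hlip.extend_real
  refine ⟨v, ?_, _, hv.lipschitzOnWith⟩
  filter_upwards [ae_restrict_mem measurableSet_Ioo, ae_restrict_of_ae (ae_deriv_prim hub)]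
    with s hs hs' using huv ⟨hs, hs'⟩

end lipschitz

namespace IsAnisotropy

variable {φ : E2 → ℝ} {t : ℝ}

lemma vec2_wulffProfile (hφ : IsAnisotropy φ) (hs : AxisSymmetric φ) (ht : |t| ≤ wulffWidth φ) :
    φ (vec2 t (wulffProfile φ t)) = 1 := by
  have h0 := hφ.wulffProfile_nonneg hs t
  refine le_antisymm ((hφ.vec2_le_one_iff hs _ _).2 ⟨ht, (abs_of_nonneg h0).le⟩) ?_
  by_contra! h
  have hc : Continuous fun s => φ (vec2 t s) :=
    hφ.continuous.comp ((contDiff_vec2 (n := 0)).continuous.comp (Continuous.prodMk_right t))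
  have h1 : ∀ᶠ s in 𝓝[>] (wulffProfile φ t), φ (vec2 t s) < 1 :=
    (hc.continuousAt.eventually_lt continuousAt_const h).filter_mono nhdsWithin_le_nhds
  obtain ⟨s, hs1, hs2⟩ := (h1.and self_mem_nhdsWithin).exists
  have h2 := ((hφ.vec2_le_one_iff hs _ _).1 hs1.le).2
  linarith [le_abs_self s, show _ < s from hs2]

lemma vec2_zero_lt_one (hφ : IsAnisotropy φ) (ht : |t| < wulffWidth φ) : φ (vec2 t 0) < 1 := by
  have e : vec2 t 0 = t • e1 := by rw [e1, smul_vec2]; simp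
  rw [e, hφ.smul_eq]
  rwa [← lt_div_iff₀ hφ.e1_pos, one_div]

lemma contDiffAt_wulffProfile (hφ : IsAnisotropy φ) (hs : AxisSymmetric φ)
    (hn : NoVerticalFacets φ) (h2 : IsC2Aniso φ) (ht : |t| < wulffWidth φ) :
    ContDiffAt ℝ 2 (wulffProfile φ) t := by
  set H := wulffProfile φ with hH
  have hprof : IsProfile (wulffWidth φ) H := hφ.isProfile hs hn
  have hHt : 0 < H t := hprof.pos_of_lt ht
  set F : ℝ × ℝ → ℝ := fun v => φ (vec2 v.1 v.2) with hF
  have hvec : ContDiff ℝ 2 fun v : ℝ × ℝ => vec2 v.1 v.2 := contDiff_vec2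
  have hne : vec2 t (H t) ≠ 0 := fun h => by
    have := congrArg (fun v : E2 => v 1) h
    simp only [vec2_one] at this
    exact hHt.ne' this
  have hFd : ContDiffAt ℝ 2 F (t, H t) :=
    ContDiffAt.comp (t, H t) ((h2 _ hne).contDiffAt (isOpen_compl_singleton.mem_nhds hne))
      hvec.contDiffAt
  set d := fderiv ℝ F (t, H t) (0, 1) with hd
  have hder : HasDerivAt (fun s => φ (vec2 t s)) d (H t) :=
    ((hFd.differentiableAt (by simp)).hasFDerivAt).comp_hasDerivAt (H t)
      ((hasDerivAt_const (H t) t).prodMk (hasDerivAt_id (H t)))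
  have hconv : ConvexOn ℝ univ fun s => φ (vec2 t s) := by
    refine ⟨convex_univ, fun x _ y _ α β hα hβ hαβ => ?_⟩
    have h3 := hφ.convexOn.2 (mem_univ (vec2 t x)) (mem_univ (vec2 t y)) hα hβ hαβ
    rw [smul_vec2, smul_vec2, vec2_add, ← add_mul, hαβ, one_mul] at h3
    exact h3
  have hd0 : 0 < d := by
    have h3 := hconv.slope_le_of_hasDerivAt (mem_univ 0) (mem_univ (H t)) hHt hder
    rw [slope_def_field, hφ.vec2_wulffProfile hs ht.le, sub_zero] at h3
    exact (div_pos (by linarith [hφ.vec2_zero_lt_one ht]) hHt).trans_le h3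
  have hinv : (fderiv ℝ F (t, H t) ∘L .inr ℝ ℝ ℝ).IsInvertible :=
    ⟨ContinuousLinearEquiv.unitsEquivAut ℝ (Units.mk0 d hd0.ne'), by ext; simp [hd]⟩
  have hψ := hFd.contDiffAt_implicitFunction (by simp) hinv
  refine hψ.congr_of_eventuallyEq ?_
  have hev := hFd.eventually_apply_eq_iff_implicitFunction (by simp) hinv
  have hlim : Tendsto (fun x => (x, H x)) (𝓝 t) (𝓝 (t, H t)) :=
    (continuous_id.prodMk hprof.cont).tendsto t
  have hlt : ∀ᶠ x in 𝓝 t, |x| < wulffWidth φ := continuous_abs.continuousAt.eventually_lt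
    continuousAt_const ht
  filter_upwards [hlim.eventually hev, hlt] with x hx hxm
  refine (hx.1 ?_).symm
  simp only [hF]
  rw [hφ.vec2_wulffProfile hs hxm.le, hφ.vec2_wulffProfile hs ht.le]

lemma exists_lipschitz_deriv_wulffProfile (hφ : IsAnisotropy φ) (hs : AxisSymmetric φ)
    (hn : NoVerticalFacets φ) (h2 : IsC2Aniso φ) (ht : |t| < wulffWidth φ) :
    ∃ (D : ℝ → ℝ) (K : ℝ≥0), BddMeas D ∧ LipschitzWith K D ∧
      ∀ x ∈ Icc (-|t|) |t|, HasDerivAt (wulffProfile φ) (D x) x := by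
  set H := wulffProfile φ with hH
  have hle : -|t| ≤ |t| := by linarith [abs_nonneg t]
  have hC : ∀ x ∈ Icc (-|t|) |t|, ContDiffAt ℝ 2 H x := fun x hx =>
    hφ.contDiffAt_wulffProfile hs hn h2 ((abs_le.2 hx).trans_lt ht)
  have hCo : ContDiffOn ℝ 2 H (Ioo (-wulffWidth φ) (wulffWidth φ)) := fun x hx =>
    (hφ.contDiffAt_wulffProfile hs hn h2 (abs_lt.2 hx)).contDiffWithinAt
  have hC1 : ContDiffOn ℝ 1 (deriv H) (Icc (-|t|) |t|) :=
    (hCo.deriv_of_isOpen isOpen_Ioo (by norm_num)).mono fun x hx => abs_lt.1 <|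
      (abs_le.2 hx).trans_lt ht
  obtain ⟨K, hK⟩ := hC1.exists_lipschitzOnWith (by simp) (convex_Icc _ _) isCompact_Icc
  obtain ⟨B, hB⟩ := isCompact_Icc.exists_bound_of_continuousOn hC1.continuousOn
  have hDl : LipschitzWith K fun x => deriv H (projIcc _ _ hle x) := by
    refine LipschitzWith.of_dist_le_mul fun x y => ?_
    refine (hK.dist_le_mul _ (projIcc _ _ hle x).2 _ (projIcc _ _ hle y).2).trans ?_
    have := (LipschitzWith.projIcc hle).dist_le_mul x y
    rw [NNReal.coe_one, one_mul] at this
    exact mul_le_mul_of_nonneg_left this K.coe_nonneg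
  refine ⟨fun x => deriv H (projIcc _ _ hle x), K, ⟨hDl.continuous.measurable, B, fun s =>
    hB _ (projIcc _ _ hle s).2⟩, hDl, fun x hx => ?_⟩
  simp only [projIcc_of_mem hle hx]
  exact ((hC x hx).differentiableAt (by simp)).hasDerivAt

end IsAnisotropy

lemma abs_sub_sub_deriv_mul_le {H D : ℝ → ℝ} {K : ℝ≥0} {t x y : ℝ} (hD : LipschitzWith K D)
    (hH : ∀ x ∈ Icc (-t) t, HasDerivAt H (D x) x) (hx : x ∈ Icc (-t) t) (hy : y ∈ Icc (-t) t) :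
    |H y - H x - D x * (y - x)| ≤ K * |y - x| ^ 2 := by
  have hsub : uIcc x y ⊆ Icc (-t) t := (ordConnected_Icc).uIcc_subset hx hy
  have h := (convex_uIcc x y).norm_image_sub_le_of_norm_hasDerivWithin_le
    (f := fun r => H r - D x * r) (f' := fun r => D r - D x * 1) (C := K * |y - x|)
    (fun r hr => ((hH r (hsub hr)).sub ((hasDerivAt_id r).const_mul (D x))).hasDerivWithinAt)
    (fun r hr => by
      rw [mul_one]
      refine (hD.dist_le_mul r x).trans (mul_le_mul_of_nonneg_left ?_ K.coe_nonneg)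
      rw [Real.dist_eq]
      exact abs_sub_left_of_mem_uIcc hr)
    left_mem_uIcc right_mem_uIcc
  rw [Real.norm_eq_abs, Real.norm_eq_abs] at h
  calc |H y - H x - D x * (y - x)| = |H y - D x * y - (H x - D x * x)| := by ring_nf
    _ ≤ K * |y - x| * |y - x| := h
    _ = K * |y - x| ^ 2 := by ring

namespace IsDualMax

variable {m t : ℝ} {H D : ℝ → ℝ} {K : ℝ≥0} {u k l : ℝ → ℝ} {a b : ℝ}

lemma neg_integral_deriv_mul_le (hab : a ≤ b) (hH : IsProfile m H) (hu : IntegrableOn u (Ioo a b))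
    (h : IsDualMax m H a b u k) (htm : t < m) (hz : ∀ s ∈ Icc a b, |prim a k s| ≤ t)
    (hD : LipschitzWith K D)
    (hHD : ∀ x ∈ Icc (-((t + m) / 2)) ((t + m) / 2), HasDerivAt H (D x) x)
    (hDb : BddMeas D) (hl : BddMeas l) (hl0 : prim a l b = 0) :
    -∫ s in Ioo a b, D (prim a k s) * prim a l s ≤ ∫ s in Ioo a b, u s * l s := by
  obtain ⟨B, hB⟩ : ∃ B, ∀ s ∈ Icc a b, |prim a l s| ≤ B := ⟨_, fun s hs => abs_prim_le hl hs⟩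
  have hlc := continuous_prim (a := a) hl
  have hkc := continuous_prim (a := a) h.bdd
  have hwb : BddMeas fun s => D (prim a k s) :=
    ⟨hDb.1.comp hkc.measurable, hDb.2.imp fun C hC s => hC _⟩
  have hli : IntegrableOn (prim a l) (Ioo a b) :=
    (hlc.continuousOn.integrableOn_Icc (a := a) (b := b)).mono_set Ioo_subset_Icc_self
  have hwi := hwb.integrable_mul_left hli
  have key : ∀ ε : ℝ, 0 < ε → ε * B ≤ (m - t) / 2 →
      -(∫ s in Ioo a b, D (prim a k s) * prim a l s) - K * B ^ 2 * (b - a) * ε ≤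
        ∫ s in Ioo a b, u s * l s := fun ε hε hεB => by
    have hεl : ∀ s ∈ Icc a b, |ε * prim a l s| ≤ ε * B := fun s hs => by
      rw [abs_mul, abs_of_pos hε]
      exact mul_le_mul_of_nonneg_left (hB s hs) hε.le
    have hzl : ∀ s ∈ Icc a b, |prim a k s - ε * prim a l s| ≤ (t + m) / 2 := fun s hs => by
      linarith [abs_sub (prim a k s) (ε * prim a l s), hz s hs, hεl s hs]
    have hmain := h.integral_sub_le hH hu (l := fun x => ε * l x) (hl.const_mul _)
      (by rw [prim_const_mul, hl0, mul_zero])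
      (fun s hs => by
        rw [prim_const_mul]
        linarith [hzl s hs])
    simp only [prim_const_mul] at hmain
    have h1 : ∫ s in Ioo a b, (-ε * (D (prim a k s) * prim a l s) - K * (ε * B) ^ 2) ≤
        ∫ s in Ioo a b, (H (prim a k s - ε * prim a l s) - H (prim a k s)) := by
      refine setIntegral_mono_on ((hwi.const_mul (-ε)).sub (integrable_const _))
        ((hH.integrableOn_comp (hkc.sub (hlc.const_mul ε)) a b).sub
          (hH.integrableOn_comp hkc a b)) measurableSet_Ioo fun x hx => ?_
      have hx' := Ioo_subset_Icc_self hx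
      have h2 := (_root_.abs_le.1 (abs_sub_sub_deriv_mul_le hD hHD
        (_root_.abs_le.1 ((hz x hx').trans (by linarith))) (_root_.abs_le.1 (hzl x hx')))).1
      have h3 : |prim a k x - ε * prim a l x - prim a k x| ^ 2 ≤ (ε * B) ^ 2 := by
        rw [sub_sub_cancel_left, abs_neg]
        exact pow_le_pow_left₀ (abs_nonneg _) (hεl x hx') 2
      have h4 := mul_le_mul_of_nonneg_left h3 K.coe_nonneg
      linarith
    rw [integral_sub (hwi.const_mul (-ε)) (integrable_const _), integral_const_mul,
      setIntegral_const, Real.volume_real_Ioo_of_le hab, smul_eq_mul] at h1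
    have e : ∫ s in Ioo a b, u s * (ε * l s) = ε * ∫ s in Ioo a b, u s * l s := by
      rw [← integral_const_mul]
      congr 1
      ext s
      ring
    rw [e] at hmain
    refine le_of_mul_le_mul_left ?_ hε
    linarith
  have hlim : Tendsto (fun ε : ℝ => -(∫ s in Ioo a b, D (prim a k s) * prim a l s) -
      K * B ^ 2 * (b - a) * ε) (𝓝[>] 0)
      (𝓝 (-(∫ s in Ioo a b, D (prim a k s) * prim a l s) - K * B ^ 2 * (b - a) * 0)) :=
    ((continuous_const.sub (continuous_const_mul _)).tendsto 0).mono_left nhdsWithin_le_nhds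
  rw [mul_zero, sub_zero] at hlim
  refine le_of_tendsto hlim ?_
  have hsmall : ∀ᶠ ε : ℝ in 𝓝[>] 0, ε * B < (m - t) / 2 := by
    refine Filter.Eventually.filter_mono nhdsWithin_le_nhds ?_
    exact (continuous_mul_const B).continuousAt.eventually_lt continuousAt_const
      (by rw [zero_mul]; linarith)
  filter_upwards [hsmall, self_mem_nhdsWithin] with ε h1 h2 using key ε h2 h1.le

lemma hasC11Rep (hab : a < b) (hH : IsProfile m H) (hub : BddMeas u)
    (h : IsDualMax m H a b u k) (htm : t < m) (hz : ∀ s ∈ Icc a b, |prim a k s| ≤ t)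
    (hD : LipschitzWith K D)
    (hHD : ∀ x ∈ Icc (-((t + m) / 2)) ((t + m) / 2), HasDerivAt H (D x) x)
    (hDb : BddMeas D) : HasC11Rep u (Ioo a b) := by
  have hu : IntegrableOn u (Ioo a b) := hub.integrableOn (by simp)
  have hkc := continuous_prim (a := a) h.bdd
  obtain ⟨L, hL⟩ := h.bdd.2
  set w : ℝ → ℝ := fun s => D (prim a k s) with hw
  have hwc : Continuous w := hD.continuous.comp hkc
  have hwb : BddMeas w := ⟨hwc.measurable, hDb.2.imp fun C hC s => hC _⟩
  have hWc := continuous_prim (a := a) hwb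
  have heq : ∀ l, BddMeas l → prim a l b = 0 →
      ∫ s in Ioo a b, u s * l s = ∫ s in Ioo a b, prim a w s * l s := fun l hl hl0 => by
    have h1 := h.neg_integral_deriv_mul_le hab.le hH hu htm hz hD hHD hDb hl hl0
    have h2 := h.neg_integral_deriv_mul_le hab.le hH hu htm hz hD hHD hDb hl.neg
      (by rw [prim_neg, hl0, neg_zero])
    simp only [prim_neg, mul_neg, integral_neg, neg_neg] at h2
    rw [integral_prim_mul hab.le hwb hl, hl0, mul_zero, zero_sub]
    linarith
  set f : ℝ → ℝ := (Ioo a b).indicator fun s => u s - prim a w s with hf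
  have hfb : BddMeas f := by
    obtain ⟨B, hB⟩ := hub.2
    refine ⟨(hub.1.sub hWc.measurable).indicator measurableSet_Ioo,
      B + ∫ r in Ioo a b, |w r|, fun s => ?_⟩
    have h0 : 0 ≤ ∫ r in Ioo a b, |w r| := integral_nonneg fun _ => abs_nonneg _
    by_cases hs : s ∈ Ioo a b
    · simp only [hf, indicator_of_mem hs]
      exact (abs_sub _ _).trans (add_le_add (hB s) (abs_prim_le hwb (Ioo_subset_Icc_self hs)))
    · simp only [hf, indicator_of_notMem hs, abs_zero]
      exact add_nonneg ((abs_nonneg _).trans (hB s)) h0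
  set c := (b - a)⁻¹ * ∫ s in Ioo a b, f s with hc
  set l : ℝ → ℝ := fun s => f s - c with hl
  have hlb : BddMeas l := hfb.sub (BddMeas.const c)
  have hl0 : ∫ s in Ioo a b, l s = 0 := by
    rw [hl, integral_sub (hfb.integrableOn (by simp)) (integrable_const _), setIntegral_const,
      Real.volume_real_Ioo_of_le hab.le, smul_eq_mul, hc,
      mul_inv_cancel_left₀ (sub_pos.2 hab).ne', sub_self]
  have hsq : ∫ s in Ioo a b, l s * l s = 0 := by
    have h1 : ∫ s in Ioo a b, f s * l s = 0 := by
      have e : ∫ s in Ioo a b, f s * l s = ∫ s in Ioo a b, (u s * l s - prim a w s * l s) :=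
        setIntegral_congr_fun measurableSet_Ioo fun s hs => by
          simp only [hf, indicator_of_mem hs]
          ring
      have hWi : IntegrableOn (prim a w) (Ioo a b) :=
        (hWc.continuousOn.integrableOn_Icc (a := a) (b := b)).mono_set Ioo_subset_Icc_self
      rw [e, integral_sub (hlb.integrable_mul hu) (hlb.integrable_mul hWi),
        heq l hlb (by rw [_root_.prim_right hab.le, hl0]), sub_self]
    have e : ∫ s in Ioo a b, l s * l s = ∫ s in Ioo a b, (f s * l s - c * l s) := by
      congr 1
      ext s
      simp only [hl]
      ring
    rw [e, integral_sub ((hfb.mul hlb).integrableOn (by simp))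
      ((hlb.const_mul c).integrableOn (by simp)), integral_const_mul, h1, hl0]
    simp
  rw [integral_eq_zero_iff_of_nonneg (fun s => mul_self_nonneg _)
    ((hlb.mul hlb).integrableOn (by simp))] at hsq
  refine ⟨fun s => prim a w s + c, w, ?_, fun s _ => ?_, K * L.toNNReal, ?_⟩
  · filter_upwards [hsq, ae_restrict_mem measurableSet_Ioo] with s hs hs'
    have h1 : l s = 0 := mul_self_eq_zero.1 hs
    simp only [hl, hf, indicator_of_mem hs'] at h1
    linarith
  · exact (intervalIntegral.integral_hasDerivAt_right (hwb.intervalIntegrable _ _)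
      (hwc.stronglyMeasurableAtFilter _ _) hwc.continuousAt).add_const c
  · have hkl : LipschitzWith L.toNNReal (prim a k) := LipschitzWith.of_dist_le_mul fun x y => by
      rw [Real.coe_toNNReal L ((abs_nonneg _).trans (hL 0))]
      exact abs_prim_sub_le h.bdd hL y x
    exact (hD.comp hkl).lipschitzOnWith

end IsDualMax

lemma ae_abs_le_of_supNorm_lt {g : ℝ → ℝ} {I : Set ℝ} {σ : ℝ} (hσ : 0 ≤ σ)
    (h : supNorm g I < ENNReal.ofReal σ) : ∀ᵐ s ∂(volume.restrict I), |g s| ≤ σ := by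
  filter_upwards [ae_lt_of_essSup_lt h] with s hs
  have h1 : (‖g s‖₊ : ℝ≥0∞) = ENNReal.ofReal |g s| := by
    rw [← Real.norm_eq_abs, ofReal_norm]
    rfl
  rw [h1] at hs
  exact (ENNReal.ofReal_le_ofReal_iff hσ).1 hs.le

lemma IsMinimizerG.congr {φ : E2 → ℝ} {p a b : ℝ} {g u w : ℝ → ℝ}
    (h : IsMinimizerG φ p g (Ioo a b) u) (huw : ∀ᵐ s ∂(volume.restrict (Ioo a b)), u s = w s) :
    IsMinimizerG φ p g (Ioo a b) w := by
  have e : Gfun φ p g (Ioo a b) w = Gfun φ p g (Ioo a b) u := by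
    rw [Gfun, Gfun, aniArea_congr huw]
    congr 1
    refine lintegral_congr_ae ?_
    filter_upwards [huw] with s hs
    rw [hs]
  exact ⟨h.1.congr_fun_ae huw, fun v hv => e.trans_le (h.2 v hv)⟩

lemma HasLipschitzRep.congr {u w : ℝ → ℝ} {I : Set ℝ} (h : HasLipschitzRep w I)
    (huw : ∀ᵐ s ∂(volume.restrict I), u s = w s) : HasLipschitzRep u I := by
  obtain ⟨v, hv, h⟩ := h
  exact ⟨v, by filter_upwards [huw, hv] with s h1 h2 using h1.trans h2, h⟩

lemma HasC11Rep.congr {u w : ℝ → ℝ} {I : Set ℝ} (h : HasC11Rep w I)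
    (huw : ∀ᵐ s ∂(volume.restrict I), u s = w s) : HasC11Rep u I := by
  obtain ⟨v, v', hv, h⟩ := h
  exact ⟨v, v', by filter_upwards [huw, hv] with s h1 h2 using h1.trans h2, h⟩

lemma exists_bddMeas_ae_eq {u : ℝ → ℝ} {a b K : ℝ} (hK : 0 ≤ K) (hum : Measurable u)
    (h : ∀ᵐ s ∂(volume.restrict (Ioo a b)), |u s| ≤ K) :
    ∃ w, Measurable w ∧ (∀ s, |w s| ≤ K) ∧ ∀ᵐ s ∂(volume.restrict (Ioo a b)), u s = w s := by
  refine ⟨fun s => max (-K) (min K (u s)), measurable_const.max (measurable_const.min hum),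
    fun s => abs_le.2 ⟨le_max_left _ _, max_le (by linarith) (min_le_left _ _)⟩, ?_⟩
  filter_upwards [h] with s hs
  rw [min_eq_right (abs_le.1 hs).2, max_eq_right (abs_le.1 hs).1]

/-- De Giorgi conjecture, `n = k = 1`, anisotropic version:
there is `σ = σ(φ,p,|I|) > 0` such that for every `g ∈ L^∞(I)` with `‖g‖_∞ < σ`,
every minimizer of `G` over `L¹(I)` is Lipschitz in `I`, and is `C^{1,1}` if
moreover `φ` is a `C²` elliptic anisotropy. -/
theorem stmt0
    (φ : E2 → ℝ) (hφ : IsAnisotropy φ) (hsym : AxisSymmetric φ) (hnv : NoVerticalFacets φ)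
    (a b : ℝ) (hab : a < b) (p : ℝ) (hp : 1 ≤ p) :
    ∃ σ > (0:ℝ), ∀ g : ℝ → ℝ,
      AEStronglyMeasurable g (volume.restrict (Set.Ioo a b)) →
      supNorm g (Set.Ioo a b) < ENNReal.ofReal σ →
      ∀ u : ℝ → ℝ, IsMinimizerG φ p g (Set.Ioo a b) u →
        HasLipschitzRep u (Set.Ioo a b) ∧
          (IsC2Aniso φ → IsElliptic φ → HasC11Rep u (Set.Ioo a b)) := by
  set m := wulffWidth φ with hm
  set H := wulffProfile φ with hHdef
  have hH : IsProfile m H := hφ.isProfile hsym hnv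
  have hW : ∀ t s, φ (vec2 t s) ≤ 1 ↔ |t| ≤ m ∧ |s| ≤ H t := hφ.vec2_le_one_iff hsym
  have hm0 := hH.m_pos
  have hH0 := hH.pos
  have hℓ : 0 < b - a := sub_pos.2 hab
  obtain ⟨t₀, q, ht₀, htm, hq, hslope⟩ := hH.exists_slope
  set t₁ := (t₀ + m) / 2 with ht₁
  set K := 4 + 2 * ((H 0 + 1) * (b - a)) / m with hK
  have hK0 : 0 < K := by positivity
  set L := p * (K + 2) ^ (p - 1) with hL
  have hL0 : 0 < L := mul_pos (by linarith) (Real.rpow_pos_of_pos (by linarith) _)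
  set R := q * ((m - t₀) / (4 * L)) ^ 2 with hR
  have hR0 : 0 < R := mul_pos hq (pow_pos (div_pos (by linarith) (by linarith)) 2)
  set σ := min 1 (R / (7 * (b - a))) with hσ
  have hσ0 : 0 < σ := lt_min one_pos (div_pos hR0 (by linarith))
  have hσ1 : σ ≤ 1 := min_le_left _ _
  have hσR : 7 * (σ * (b - a)) ≤ R := by
    have h1 : σ ≤ R / (7 * (b - a)) := min_le_right _ _
    rw [le_div_iff₀ (by linarith)] at h1
    linarith
  refine ⟨σ, hσ0, fun g hg hgσ u hu => ?_⟩
  have hgσ' := ae_abs_le_of_supNorm_lt hσ0.le hgσ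
  obtain ⟨u₁, hu₁, huu₁⟩ : ∃ u₁, Measurable u₁ ∧
      ∀ᵐ s ∂(volume.restrict (Ioo a b)), u s = u₁ s :=
    ⟨_, hu.1.aestronglyMeasurable.stronglyMeasurable_mk.measurable,
      hu.1.aestronglyMeasurable.ae_eq_mk⟩
  have hmin₁ := hu.congr huu₁
  obtain ⟨hA₁, hA₁le, hint₁⟩ := hmin₁.energy_estimates hab hH hW hp hσ0 hg hgσ'
  have hbound : ∀ᵐ s ∂(volume.restrict (Ioo a b)), |u₁ s| ≤ K := by
    refine ae_abs_le_of_aniArea hab hH hW hu₁ hmin₁.1 hA₁ ?_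
    have h1 : (∫ s in Ioo a b, |u₁ s|) / (b - a) ≤ 3 := by
      rw [div_le_iff₀ hℓ]
      nlinarith
    have h2 : 2 * (aniArea φ u₁ (Ioo a b)).toReal / m ≤ 2 * ((H 0 + 1) * (b - a)) / m := by
      have h3 : σ ^ p ≤ 1 := Real.rpow_le_one hσ0.le hσ1 (by linarith)
      have h4 : (H 0 + σ ^ p) * (b - a) ≤ (H 0 + 1) * (b - a) :=
        mul_le_mul_of_nonneg_right (by linarith) hℓ.le
      gcongr
      linarith
    linarith
  obtain ⟨w, hwm, hwK, hu₁w⟩ := exists_bddMeas_ae_eq hK0.le hu₁ hbound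
  have huw : ∀ᵐ s ∂(volume.restrict (Ioo a b)), u s = w s := by
    filter_upwards [huu₁, hu₁w] with s h1 h2 using h1.trans h2
  have hwb : BddMeas w := ⟨hwm, K, hwK⟩
  have hmin := hu.congr huw
  obtain ⟨hA, -, hint⟩ := hmin.energy_estimates hab hH hW hp hσ0 hg hgσ'
  have hg1 : ∀ᵐ s ∂(volume.restrict (Ioo a b)), |g s| ≤ 1 := by
    filter_upwards [hgσ'] with s hs using hs.trans hσ1
  obtain ⟨k, hk, hkL⟩ := exists_isDualMax hab hH hW hL0.le hwb hA fun v hv hAv =>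
    hmin.toReal_aniArea_le hp hg hg1 hwb hwK hA hv hAv
  have hsmall : 2 * ∫ s in Ioo a b, |w s| < R := by
    have : 0 < σ * (b - a) := mul_pos hσ0 hℓ
    linarith
  have hz : ∀ s ∈ Icc a b, |prim a k s| ≤ t₁ := fun s hs =>
    hk.abs_prim_le_of_small hH hmin.1 hL0 hkL ht₀ htm hq hslope hsmall hs
  have ht₁m : t₁ < m := by rw [ht₁]; linarith
  have ht₂ : 0 ≤ (t₁ + m) / 2 := by rw [ht₁]; linarith
  have ht₂m : (t₁ + m) / 2 < m := by linarith
  refine ⟨?_, fun hC2 _ => ?_⟩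
  · obtain ⟨C, hC, hCH⟩ := hH.exists_lipschitz ht₂ ht₂m
    exact (hasLipschitzRep_of_integral_mul_le hwb (fun l hl hl0 =>
      hk.abs_integral_mul_le hH hmin.1 ht₁m hz hCH hl hl0) hC).congr huw
  · obtain ⟨D, K', hDb, hD, hHD⟩ := hφ.exists_lipschitz_deriv_wulffProfile hsym hnv hC2
      (t := (t₁ + m) / 2) (by rwa [abs_of_nonneg ht₂])
    rw [abs_of_nonneg ht₂] at hHD
    exact (hk.hasC11Rep hab hH hwb ht₁m hz hD hHD hDb).congr huw


end
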